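/- A function Q ∈ S^{km}_{ℓ;ν}(ℝ^{2n+1}) satisfies L_A Q = 0 for every affine contact vector field A — equivalently for each of the generators X_1, X_{p_i}, X_{q^i}, X_t, X_{p_ip_j}, X_{q^iq^j}, X_{p_jq^i} — if and only if Q is a linear combination of the monomials u_1^a u_2^b u_3^c u_4^d u_5^e L_1^f over all (a,b,c,d,e,f) ∈ ℕ^6 satisfying a+d+f = k, b+e+f = m, a+b+c = ℓ, and d+e+f−c = (n+1)ν. In particular, a nonzero invariant exists only if (n+1)ν is an integer. -/

import Mathlib

set_option linter.unusedVariables false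

open scoped BigOperators

noncomputable section

/-- Partial derivative of `f : ℝ^ι → ℝ` in the `i`-th coordinate direction. -/
def pd {ι : Type*} [Fintype ι] [DecidableEq ι] (i : ι) (f : (ι → ℝ) → ℝ) (x : ι → ℝ) : ℝ :=
  fderiv ℝ f x (Pi.single i 1)

/-- Index of the coordinate `p_i` in `ℝ^{2n+1}`. -/
def pIdx (n : ℕ) (i : Fin n) : Fin (2*n+1) := ⟨i.1, by have := i.isLt; omega⟩
/-- Index of the coordinate `q^i` in `ℝ^{2n+1}`. -/
def qIdx (n : ℕ) (i : Fin n) : Fin (2*n+1) := ⟨n + i.1, by have := i.isLt; omega⟩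
/-- Index of the coordinate `t` in `ℝ^{2n+1}`. -/
def tIdx (n : ℕ) : Fin (2*n+1) := ⟨2*n, by omega⟩

/-- The contact Hamiltonian vector field `X_h` of a function `h` on `ℝ^{2n+1}`:
`X_h = Σ_k (∂_{p_k}h ∂_{q^k} − ∂_{q^k}h ∂_{p_k}) + (ℰ_s h)∂_t − (∂_t h)ℰ_s − 2h∂_t`. -/
def contactHam (n : ℕ) (h : (Fin (2*n+1) → ℝ) → ℝ) (x : Fin (2*n+1) → ℝ) :
    Fin (2*n+1) → ℝ :=
  fun a =>
    if ha : a.1 < n then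
      -pd (qIdx n ⟨a.1, ha⟩) h x - pd (tIdx n) h x * x a
    else if ha' : a.1 < 2*n then
      pd (pIdx n ⟨a.1 - n, by omega⟩) h x - pd (tIdx n) h x * x a
    else
      (∑ k : Fin n, (x (pIdx n k) * pd (pIdx n k) h x + x (qIdx n k) * pd (qIdx n k) h x))
        - 2 * h x

/-- Points of `ℝ^{2n+1}`. -/
abbrev Vc (n : ℕ) : Type := Fin (2*n+1) → ℝ

/-- Partial derivative in the base variable `x`. -/
def pdX (n : ℕ) (i : Fin (2*n+1)) (Q : Vc n → Vc n → Vc n → Vc n → ℝ)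
    (x ξ η Y : Vc n) : ℝ :=
  fderiv ℝ (fun y => Q y ξ η Y) x (Pi.single i 1)

/-- Partial derivative in the fiber variable `ξ`. -/
def pdXi (n : ℕ) (i : Fin (2*n+1)) (Q : Vc n → Vc n → Vc n → Vc n → ℝ)
    (x ξ η Y : Vc n) : ℝ :=
  fderiv ℝ (fun ζ => Q x ζ η Y) ξ (Pi.single i 1)

/-- Partial derivative in the fiber variable `η`. -/
def pdEta (n : ℕ) (i : Fin (2*n+1)) (Q : Vc n → Vc n → Vc n → Vc n → ℝ)
    (x ξ η Y : Vc n) : ℝ :=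
  fderiv ℝ (fun ζ => Q x ξ ζ Y) η (Pi.single i 1)

/-- Partial derivative in the fiber variable `Y`. -/
def pdYv (n : ℕ) (i : Fin (2*n+1)) (Q : Vc n → Vc n → Vc n → Vc n → ℝ)
    (x ξ η Y : Vc n) : ℝ :=
  fderiv ℝ (fun ζ => Q x ξ η ζ) Y (Pi.single i 1)

/-- `Q` belongs to `S^{km}_{ℓ;ν}(ℝ^{2n+1})`: smooth in all variables and homogeneous of
degree `k` in `ξ`, `m` in `η`, `l` in `Y`. -/
def InS (n k m l : ℕ) (Q : Vc n → Vc n → Vc n → Vc n → ℝ) : Prop :=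
  ContDiff ℝ (⊤ : ℕ∞) (fun p : (Vc n × Vc n) × (Vc n × Vc n) => Q p.1.1 p.1.2 p.2.1 p.2.2) ∧
  (∀ x ξ η Y (c : ℝ), Q x (c • ξ) η Y = c ^ k * Q x ξ η Y) ∧
  (∀ x ξ η Y (c : ℝ), Q x ξ (c • η) Y = c ^ m * Q x ξ η Y) ∧
  (∀ x ξ η Y (c : ℝ), Q x ξ η (c • Y) = c ^ l * Q x ξ η Y)

/-- The action of a vector field `Xf` on `S^{km}_{ℓ;ν}`:
`L_X Q = X(Q) − Σ∂_jX^i η_i ∂_{η_j}Q − Σ∂_jX^i ξ_i ∂_{ξ_j}Q + Σ∂_jX^i Y^j ∂_{Y^i}Q + ν(div X)Q`. -/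
def LAct3 (n : ℕ) (ν : ℝ) (Xf : Vc n → Vc n) (Q : Vc n → Vc n → Vc n → Vc n → ℝ)
    (x ξ η Y : Vc n) : ℝ :=
  (∑ i, Xf x i * pdX n i Q x ξ η Y)
  - (∑ i, ∑ j, pd j (fun y => Xf y i) x * η i * pdEta n j Q x ξ η Y)
  - (∑ i, ∑ j, pd j (fun y => Xf y i) x * ξ i * pdXi n j Q x ξ η Y)
  + (∑ i, ∑ j, pd j (fun y => Xf y i) x * Y j * pdYv n i Q x ξ η Y)
  + ν * (∑ i, pd i (fun y => Xf y i) x) * Q x ξ η Y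

/-- `u_1 = ⟨Y,ξ⟩`. -/
def u1 (n : ℕ) (x ξ η Y : Vc n) : ℝ := ∑ i, Y i * ξ i
/-- `u_2 = ⟨Y,η⟩`. -/
def u2 (n : ℕ) (x ξ η Y : Vc n) : ℝ := ∑ i, Y i * η i
/-- `u_3 = α(Y)`. -/
def u3 (n : ℕ) (x ξ η Y : Vc n) : ℝ :=
  (1/2) * ((∑ k : Fin n, (x (pIdx n k) * Y (qIdx n k) - x (qIdx n k) * Y (pIdx n k)))
    - Y (tIdx n))
/-- `u_4 = −2ξ_t`. -/
def u4 (n : ℕ) (x ξ η Y : Vc n) : ℝ := -2 * ξ (tIdx n)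
/-- `u_5 = −2η_t`. -/
def u5 (n : ℕ) (x ξ η Y : Vc n) : ℝ := -2 * η (tIdx n)
/-- `L_1 = Σ_k (ξ_{p_k}η_{q^k} − ξ_{q^k}η_{p_k}) + η_t⟨ℰ_s,ξ_s⟩ − ξ_t⟨ℰ_s,η_s⟩`. -/
def L1p (n : ℕ) (x ξ η Y : Vc n) : ℝ :=
  (∑ k : Fin n, (ξ (pIdx n k) * η (qIdx n k) - ξ (qIdx n k) * η (pIdx n k)))
  + η (tIdx n) * (∑ k : Fin n, (x (pIdx n k) * ξ (pIdx n k) + x (qIdx n k) * ξ (qIdx n k)))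
  - ξ (tIdx n) * (∑ k : Fin n, (x (pIdx n k) * η (pIdx n k) + x (qIdx n k) * η (qIdx n k)))

/-- Contact Hamiltonians of the generators of the affine contact algebra:
the functions `1, p_i, q^i, t, p_ip_j, q^iq^j, p_jq^i`. -/
def IsAffGen (n : ℕ) (h : Vc n → ℝ) : Prop :=
  h = (fun _ => 1) ∨
  (∃ i, h = fun x => x (pIdx n i)) ∨
  (∃ i, h = fun x => x (qIdx n i)) ∨
  h = (fun x => x (tIdx n)) ∨
  (∃ i j, h = fun x => x (pIdx n i) * x (pIdx n j)) ∨
  (∃ i j, h = fun x => x (qIdx n i) * x (qIdx n j)) ∨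
  (∃ i j, h = fun x => x (pIdx n j) * x (qIdx n i))

/-- `g` is a polynomial function of degree at most `k`. -/
def IsPolyLE (k : ℕ) (g : ℝ → ℝ) : Prop :=
  ∃ P : Polynomial ℝ, P.natDegree ≤ k ∧ ∀ τ, g τ = P.eval τ

/-- The `d`-th coefficient of the polynomial of degree at most `k` interpolating `g` at
`0, …, k`. -/
def interpCoeff (k d : ℕ) (g : ℝ → ℝ) : ℝ :=
  ∑ j ∈ Finset.range (k + 1),
    g j * (Lagrange.basis (Finset.range (k + 1)) (fun i : ℕ => (i : ℝ)) j).coeff d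

theorem interpCoeff_eval {k : ℕ} (d : ℕ) {P : Polynomial ℝ} (hP : P.natDegree ≤ k) :
    interpCoeff k d (fun τ => P.eval τ) = P.coeff d := by
  have hinj : Set.InjOn (fun i : ℕ => (i : ℝ)) (Finset.range (k + 1)) :=
    fun a _ b _ h => Nat.cast_injective h
  have hdeg : P.degree < (Finset.range (k + 1)).card := by
    rw [Finset.card_range]
    exact lt_of_le_of_lt Polynomial.degree_le_natDegree
      (by exact_mod_cast Nat.lt_succ_of_le hP)
  conv_rhs => rw [Lagrange.eq_interpolate hinj hdeg, Lagrange.interpolate_apply,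
    Polynomial.finsetSum_coeff]
  simp [interpCoeff, Polynomial.coeff_C_mul]

theorem IsPolyLE.eq_sum {k : ℕ} {g : ℝ → ℝ} (hg : IsPolyLE k g) (τ : ℝ) :
    g τ = ∑ d ∈ Finset.range (k + 1), interpCoeff k d g * τ ^ d := by
  obtain ⟨P, hP, h⟩ := hg
  obtain rfl : g = fun τ => P.eval τ := funext h
  simp only [interpCoeff_eval _ hP]
  exact Polynomial.eval_eq_sum_range' (Nat.lt_succ_of_le hP) τ

theorem IsPolyLE.interpCoeff_comp_mul {k : ℕ} {g : ℝ → ℝ} (hg : IsPolyLE k g) (d : ℕ) (c : ℝ) :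
    interpCoeff k d (fun τ => g (c * τ)) = c ^ d * interpCoeff k d g := by
  obtain ⟨P, hP, h⟩ := hg
  obtain rfl : g = fun τ => P.eval τ := funext h
  have : (fun τ => P.eval (c * τ)) = fun τ => (P.comp (Polynomial.C c * Polynomial.X)).eval τ := by
    funext τ; simp
  rw [this, interpCoeff_eval, interpCoeff_eval _ hP, Polynomial.comp_C_mul_X_coeff, mul_comm]
  refine (Polynomial.natDegree_comp_le).trans ?_
  calc _ ≤ P.natDegree * 1 := Nat.mul_le_mul_left _ ((Polynomial.natDegree_C_mul_le _ _).trans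
        Polynomial.natDegree_X_le)
    _ ≤ k := by simpa using hP

theorem interpCoeff_const_mul (k d : ℕ) (c : ℝ) (g : ℝ → ℝ) :
    interpCoeff k d (fun τ => c * g τ) = c * interpCoeff k d g := by
  simp [interpCoeff, Finset.mul_sum, mul_assoc]

theorem IsPolyLE.const_mul {k : ℕ} {g : ℝ → ℝ} (hg : IsPolyLE k g) (c : ℝ) :
    IsPolyLE k (fun τ => g τ * c) := by
  obtain ⟨P, hP, h⟩ := hg
  exact ⟨P * Polynomial.C c, (Polynomial.natDegree_mul_C_le _ _).trans hP, fun τ => by simp [h]⟩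

theorem IsPolyLE.sum {ι : Type*} (s : Finset ι) {k : ℕ} {g : ι → ℝ → ℝ}
    (hg : ∀ i ∈ s, IsPolyLE k (g i)) : IsPolyLE k (fun τ => ∑ i ∈ s, g i τ) := by
  classical
  choose! P hP h using hg
  refine ⟨∑ i ∈ s, P i, Polynomial.natDegree_sum_le_of_forall_le _ _ hP, fun τ => ?_⟩
  rw [Polynomial.eval_finsetSum]
  exact Finset.sum_congr rfl fun i hi => h i hi τ

theorem IsPolyLE.interpCoeff {k k' d : ℕ} {g : ℝ → ℝ → ℝ} (hg : ∀ σ, IsPolyLE k (fun τ => g τ σ)) :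
    IsPolyLE k (fun τ => interpCoeff k' d (g τ)) :=
  IsPolyLE.sum _ fun i _ => (hg i).const_mul _

theorem IsPolyLE.of_hasDerivAt {k : ℕ} {g g' : ℝ → ℝ} (hg : ∀ τ, HasDerivAt g (g' τ) τ)
    (hg' : IsPolyLE k g') : IsPolyLE (k + 1) g := by
  obtain ⟨P, hP, h⟩ := hg'
  set R : Polynomial ℝ := ∑ i ∈ Finset.range (k + 1),
    Polynomial.C (P.coeff i / (i + 1)) * Polynomial.X ^ (i + 1) with hR
  have hRd : Polynomial.derivative R = P := by
    conv_rhs => rw [P.as_sum_range' (k + 1) (Nat.lt_succ_of_le hP)]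
    rw [hR, Polynomial.derivative_sum]
    refine Finset.sum_congr rfl fun i _ => ?_
    rw [Polynomial.derivative_C_mul_X_pow, ← Polynomial.C_mul_X_pow_eq_monomial]
    congr 2
    push_cast
    have : (i : ℝ) + 1 ≠ 0 := by positivity
    field_simp
  have hconst : ∀ τ, g τ - R.eval τ = g 0 - R.eval 0 := by
    intro τ
    refine is_const_of_deriv_eq_zero (f := fun τ => g τ - R.eval τ)
      (fun t => ((hg t).sub (R.hasDerivAt t)).differentiableAt) (fun t => ?_) τ 0
    have hd : HasDerivAt (fun τ => g τ - R.eval τ) _ t := (hg t).sub (R.hasDerivAt t)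
    rw [hd.deriv, hRd, h, sub_self]
  refine ⟨R + Polynomial.C (g 0 - R.eval 0), ?_, fun τ => ?_⟩
  · refine (Polynomial.natDegree_add_C).le.trans ?_
    refine Polynomial.natDegree_sum_le_of_forall_le _ _ fun i hi => ?_
    refine (Polynomial.natDegree_C_mul_X_pow_le _ _).trans ?_
    have := Finset.mem_range.1 hi
    omega
  · rw [Polynomial.eval_add, Polynomial.eval_C, ← hconst τ]; ring

/-- A smooth function that is homogeneous of degree `k` is polynomial along lines. -/
theorem isPolyLE_of_homogeneous {V : Type*} [NormedAddCommGroup V] [NormedSpace ℝ V] (k : ℕ) :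
    ∀ (f : V → ℝ), ContDiff ℝ (⊤ : ℕ∞) f → (∀ (c : ℝ) v, f (c • v) = c ^ k * f v) →
      ∀ v w, IsPolyLE k (fun τ => f (v + τ • w)) := by
  induction k with
  | zero =>
    intro f _ hom v w
    refine ⟨Polynomial.C (f 0), by simp, fun τ => ?_⟩
    have := hom 0 (v + τ • w)
    simp only [zero_smul, pow_zero, one_mul] at this
    simp [this]
  | succ k ih =>
    intro f hf hom v w
    have hdiff : Differentiable ℝ f := hf.differentiable (by simp)
    have hf' : ContDiff ℝ (⊤ : ℕ∞) (fun v => fderiv ℝ f v w) :=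
      (hf.fderiv_right (m := (⊤ : ℕ∞)) (by simp)).clm_apply contDiff_const
    have hom1 : ∀ c : ℝ, c ≠ 0 → ∀ v, fderiv ℝ f (c • v) w = c ^ k * fderiv ℝ f v w := by
      intro c hc v
      have h1 : HasFDerivAt (fun v => f (c • v)) ((fderiv ℝ f (c • v)).comp
          (c • ContinuousLinearMap.id ℝ V)) v :=
        (hdiff (c • v)).hasFDerivAt.comp v ((hasFDerivAt_id v).const_smul c)
      have h2 : HasFDerivAt (fun v => f (c • v)) (c ^ (k + 1) • fderiv ℝ f v) v := by
        rw [funext (hom c)]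
        exact (hdiff v).hasFDerivAt.const_smul (c ^ (k + 1))
      have h3 := congrArg (fun L : V →L[ℝ] ℝ => L w) (h1.unique h2)
      simp only [ContinuousLinearMap.comp_apply, smul_apply,
        ContinuousLinearMap.id_apply, map_smul, smul_eq_mul] at h3
      apply mul_left_cancel₀ hc
      rw [h3]; ring
    have hom2 : ∀ (c : ℝ) v, fderiv ℝ f (c • v) w = c ^ k * fderiv ℝ f v w := by
      intro c v
      have hc1 : Continuous fun c : ℝ => fderiv ℝ f (c • v) w :=
        hf'.continuous.comp (continuous_id.smul continuous_const)
      have hc2 : Continuous fun c : ℝ => c ^ k * fderiv ℝ f v w := by fun_prop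
      have := hc1.ext_on (dense_compl_singleton (0 : ℝ)) hc2 fun c hc => hom1 c hc v
      exact congrFun this c
    refine IsPolyLE.of_hasDerivAt (g' := fun τ => fderiv ℝ f (v + τ • w) w) (fun τ => ?_)
      (ih _ hf' hom2 v w)
    have hl : HasDerivAt (fun τ : ℝ => v + τ • w) w τ := by
      simpa using ((hasDerivAt_id τ).smul_const w).const_add v
    exact (hdiff _).hasFDerivAt.comp_hasDerivAt τ hl
/-- Two continuous functions that agree off the zeros of a nonzero polynomial are equal. -/
theorem Continuous.eq_of_eq_off_roots {f g : ℝ → ℝ} (hf : Continuous f) (hg : Continuous g)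
    {P : Polynomial ℝ} (hP : P ≠ 0) (h : ∀ τ, P.eval τ ≠ 0 → f τ = g τ) : f = g := by
  have hfin : {τ : ℝ | P.eval τ = 0}.Finite := by
    refine (P.roots.toFinset.finite_toSet).subset fun τ hτ => ?_
    simpa [hP] using hτ
  exact hf.ext_on (hfin.countable.dense_compl ℝ) hg fun τ hτ => h τ hτ

section Symplectic

variable {E : Type*} [AddCommGroup E] [Module ℝ E] (ω : E →ₗ[ℝ] E →ₗ[ℝ] ℝ)

/-- The symplectic transvection `v ↦ v + c ω(u,v) u`. -/
def transv (u : E) (c : ℝ) : E →ₗ[ℝ] E :=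
  LinearMap.id + (c • ω u).smulRight u

theorem transv_apply (u : E) (c : ℝ) (v : E) : transv ω u c v = v + (c * ω u v) • u := by
  simp [transv]

/-- The monoid of linear maps generated by the symplectic transvections. -/
def transvMonoid : Submonoid (Module.End ℝ E) :=
  Submonoid.closure {g | ∃ u c, g = transv ω u c}

variable {ω}

theorem transv_mem (u : E) (c : ℝ) : transv ω u c ∈ transvMonoid ω :=
  Submonoid.subset_closure ⟨u, c, rfl⟩

/-- A vector can be moved to another one pairing nontrivially with it by a transvection that
fixes everything orthogonal to the difference. -/
theorem exists_transv_eq (halt : ω.IsAlt) {v v' : E} (h : ω v v' ≠ 0) :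
    ∃ g ∈ transvMonoid ω, g v = v' ∧ ∀ w, ω (v' - v) w = 0 → g w = w := by
  refine ⟨_, transv_mem (v' - v) (ω v' v)⁻¹, ?_, fun w hw => ?_⟩
  · have h' : ω v' v ≠ 0 := by
      rw [← halt.neg]; exact neg_ne_zero.2 h
    rw [transv_apply, map_sub, LinearMap.sub_apply, halt.self_eq_zero v, sub_zero,
      inv_mul_cancel₀ h', one_smul, add_sub_cancel]
  · rw [transv_apply, hw, mul_zero, zero_smul, add_zero]

theorem exists_transv_vector (halt : ω.IsAlt) (hnd : ∀ v, v ≠ 0 → ∃ w, ω v w ≠ 0) {v v' : E}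
    (hv : v ≠ 0) (hv' : v' ≠ 0) : ∃ g ∈ transvMonoid ω, g v = v' := by
  by_cases h : ω v v' = 0
  · obtain ⟨w, hw, hw'⟩ : ∃ w, ω v w ≠ 0 ∧ ω v' w ≠ 0 := by
      obtain ⟨a, ha⟩ := hnd v hv
      obtain ⟨b, hb⟩ := hnd v' hv'
      by_cases h1 : ω v' a = 0
      · by_cases h2 : ω v b = 0
        · exact ⟨a + b, by simp [h2, ha], by simp [h1, hb]⟩
        · exact ⟨b, h2, hb⟩
      · exact ⟨a, ha, h1⟩
    obtain ⟨g, hg, h1, -⟩ := exists_transv_eq halt hw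
    have hw'' : ω w v' ≠ 0 := by rw [← halt.neg]; exact neg_ne_zero.2 hw'
    obtain ⟨g', hg', h2, -⟩ := exists_transv_eq halt hw''
    exact ⟨g' * g, mul_mem hg' hg, by rw [Module.End.mul_apply, h1, h2]⟩
  · obtain ⟨g, hg, h1, -⟩ := exists_transv_eq halt h
    exact ⟨g, hg, h1⟩

theorem transvMonoid_preserves (halt : ω.IsAlt) {g : Module.End ℝ E} (hg : g ∈ transvMonoid ω)
    (v w : E) : ω (g v) (g w) = ω v w := by
  induction hg using Submonoid.closure_induction generalizing v w with
  | mem x hx =>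
    obtain ⟨u, c, rfl⟩ := hx
    rw [transv_apply, transv_apply]
    simp only [map_add, map_smul, LinearMap.add_apply, LinearMap.smul_apply, smul_eq_mul,
      halt.self_eq_zero u]
    rw [← halt.neg u v]; ring
  | one => rfl
  | mul x y _ _ hx hy => rw [Module.End.mul_apply, Module.End.mul_apply, hx, hy]

theorem exists_transv_pair (halt : ω.IsAlt) (hnd : ∀ v, v ≠ 0 → ∃ w, ω v w ≠ 0)
    {v₁ v₂ w₁ w₂ : E} (h0 : ω v₁ v₂ ≠ 0) (h : ω v₁ v₂ = ω w₁ w₂) :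
    ∃ g ∈ transvMonoid ω, g v₁ = w₁ ∧ g v₂ = w₂ := by
  have hv₁ : v₁ ≠ 0 := by rintro rfl; simp at h0
  have hw₁ : w₁ ≠ 0 := by rintro rfl; simp [h] at h0
  obtain ⟨g, hg, hgv⟩ := exists_transv_vector halt hnd hv₁ hw₁
  have hx : ω w₁ (g v₂) = ω w₁ w₂ := by
    rw [← h, ← hgv, transvMonoid_preserves halt hg]
  have hne : ω w₁ w₂ ≠ 0 := h ▸ h0
  suffices H : ∃ g' ∈ transvMonoid ω, g' w₁ = w₁ ∧ g' (g v₂) = w₂ by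
    obtain ⟨g', hg', h1, h2⟩ := H
    exact ⟨g' * g, mul_mem hg' hg, by rw [Module.End.mul_apply, hgv, h1],
      by rw [Module.End.mul_apply, h2]⟩
  generalize g v₂ = x at hx
  have move : ∀ {x y : E}, ω w₁ x = ω w₁ y → ω x y ≠ 0 →
      ∃ g' ∈ transvMonoid ω, g' w₁ = w₁ ∧ g' x = y := by
    intro x y hxy hne
    obtain ⟨g', hg', h1, h2⟩ := exists_transv_eq halt hne
    refine ⟨g', hg', h2 _ ?_, h1⟩
    rw [← halt.neg, map_sub, hxy, sub_self, neg_zero]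
  by_cases hxw : ω x w₂ = 0
  · obtain ⟨g₁, hg₁, h1, h2⟩ := move (x := x) (y := x + w₁)
      (by rw [map_add, halt.self_eq_zero, add_zero]) (by
        rw [map_add, halt.self_eq_zero, zero_add, ← halt.neg, hx]; exact neg_ne_zero.2 hne)
    obtain ⟨g₂, hg₂, h3, h4⟩ := move (x := x + w₁) (y := w₂)
      (by rw [map_add, halt.self_eq_zero, add_zero, hx]) (by
        rw [map_add, LinearMap.add_apply, hxw, zero_add]; exact hne)
    exact ⟨g₂ * g₁, mul_mem hg₂ hg₁, by rw [Module.End.mul_apply, h1, h3],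
      by rw [Module.End.mul_apply, h2, h4]⟩
  · exact move hx hxw

/-- Two functions of three vectors, continuous along lines, agree as soon as they agree where
`ω(v₁,v₂)` and `ω(v₂,v₃)` do not vanish. -/
theorem eq_of_eq_generic (halt : ω.IsAlt) {e f : E} (hef : ω e f = 1) {F G : E → E → E → ℝ}
    (hF : ∀ a a' b b' c c', Continuous fun τ : ℝ => F (a + τ • a') (b + τ • b') (c + τ • c'))
    (hG : ∀ a a' b b' c c', Continuous fun τ : ℝ => G (a + τ • a') (b + τ • b') (c + τ • c'))
    (h : ∀ v₁ v₂ v₃, ω v₁ v₂ ≠ 0 → ω v₂ v₃ ≠ 0 → F v₁ v₂ v₃ = G v₁ v₂ v₃) (v₁ v₂ v₃ : E) :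
    F v₁ v₂ v₃ = G v₁ v₂ v₃ := by
  let line : E → E → E → E → Polynomial ℝ := fun a a' b b' =>
    Polynomial.C (ω a b) + Polynomial.C (ω a b' + ω a' b) * Polynomial.X
      + Polynomial.C (ω a' b') * Polynomial.X ^ 2
  have hline : ∀ a a' b b' τ, (line a a' b b').eval τ = ω (a + τ • a') (b + τ • b') := by
    intro a a' b b' τ
    simp [line]; ring
  let P := line v₁ (e - v₁) v₂ (f - v₂) * line v₂ (f - v₂) v₃ (e - v₃)
  have hfe : ω f e = -1 := by rw [← halt.neg, hef]
  have hP : P ≠ 0 := by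
    intro h0
    have := congrArg (Polynomial.eval 1) h0
    simp only [P, Polynomial.eval_mul, hline, one_smul, add_sub_cancel, hef, hfe,
      Polynomial.eval_zero] at this
    norm_num at this
  have := congrFun (Continuous.eq_of_eq_off_roots (hF v₁ (e - v₁) v₂ (f - v₂) v₃ (e - v₃))
    (hG v₁ (e - v₁) v₂ (f - v₂) v₃ (e - v₃)) hP fun τ hτ => ?_) 0
  · simpa using this
  · simp only [P, Polynomial.eval_mul, hline] at hτ
    exact h _ _ _ (left_ne_zero_of_mul hτ) (right_ne_zero_of_mul hτ)

/-- Trihomogeneous symplectic invariants of three vectors are multiples of the monomial in the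
pairings `ω(v₁,v₂)`, `ω(v₁,v₃)`, `ω(v₂,v₃)` of the corresponding degrees. -/
theorem symplectic_invariant_of_three_vectors (halt : ω.IsAlt)
    (hnd : ∀ v, v ≠ 0 → ∃ w, ω v w ≠ 0) {e f : E} (hef : ω e f = 1) {k m l l' : ℕ}
    (F : E → E → E → ℝ)
    (hcont : ∀ a a' b b' c c', Continuous fun τ : ℝ => F (a + τ • a') (b + τ • b') (c + τ • c'))
    (hpoly : ∀ v₁ v₂ u w, IsPolyLE l' (fun τ => F v₁ v₂ (u + τ • w)))
    (hk : ∀ c : ℝ, c ≠ 0 → ∀ v₁ v₂ v₃, F (c • v₁) v₂ v₃ = c ^ k * F v₁ v₂ v₃)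
    (hm : ∀ c : ℝ, c ≠ 0 → ∀ v₁ v₂ v₃, F v₁ (c • v₂) v₃ = c ^ m * F v₁ v₂ v₃)
    (hl : ∀ c : ℝ, c ≠ 0 → ∀ v₁ v₂ v₃, F v₁ v₂ (c • v₃) = c ^ l * F v₁ v₂ v₃)
    (hinv : ∀ u c v₁ v₂ v₃,
      F (transv ω u c v₁) (transv ω u c v₂) (transv ω u c v₃) = F v₁ v₂ v₃) :
    (∀ v₁ v₂ v₃, F v₁ v₂ v₃ = 0) ∨ ∃ (α β γ : ℕ) (C : ℝ), α + β = k ∧ α + γ = m ∧ β + γ = l ∧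
      ∀ v₁ v₂ v₃, F v₁ v₂ v₃ = C * ω v₁ v₂ ^ α * ω v₁ v₃ ^ β * ω v₂ v₃ ^ γ := by
  have hfe : ω f e = -1 := by rw [← halt.neg, hef]
  have hinv' : ∀ g ∈ transvMonoid ω, ∀ v₁ v₂ v₃, F (g v₁) (g v₂) (g v₃) = F v₁ v₂ v₃ := by
    intro g hg
    induction hg using Submonoid.closure_induction with
    | mem x hx => obtain ⟨u, c, rfl⟩ := hx; exact hinv u c
    | one => intros; rfl
    | mul x y _ _ hx hy => intro v₁ v₂ v₃; simp only [Module.End.mul_apply, hx, hy]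
  -- the component of the third vector orthogonal to the first two is irrelevant
  have hproj : ∀ v₁ v₂ v₃ w, ω v₁ v₂ ≠ 0 → ω v₁ w = 0 → ω v₂ w = 0 →
      v₃ ∈ Submodule.span ℝ {v₁, v₂} → F v₁ v₂ (v₃ + w) = F v₁ v₂ v₃ := by
    intro v₁ v₂ v₃ w h12 h1 h2 hv₃
    obtain ⟨p, q, rfl⟩ := Submodule.mem_span_pair.1 hv₃
    rcases eq_or_ne w 0 with rfl | hw
    · rw [add_zero]
    have h21 : ω v₂ v₁ = -ω v₁ v₂ := by rw [halt.neg]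
    have hw1 : ω w v₁ = 0 := by rw [← halt.neg, h1, neg_zero]
    have hw2 : ω w v₂ = 0 := by rw [← halt.neg, h2, neg_zero]
    obtain ⟨z, hz⟩ := hnd w hw
    obtain ⟨y, hy1, hy2, hwy⟩ : ∃ y, ω v₁ y = 0 ∧ ω v₂ y = 0 ∧ ω w y ≠ 0 := by
      refine ⟨z + (ω v₂ z / ω v₁ v₂) • v₁ - (ω v₁ z / ω v₁ v₂) • v₂, ?_, ?_, ?_⟩
      · simp [halt.self_eq_zero v₁]; field_simp; ring
      · simp [halt.self_eq_zero v₂, h21]; field_simp; ring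
      · simpa [hw1, hw2] using hz
    have hmove : ∀ s : ℝ, s ≠ 0 → F v₁ v₂ (p • v₁ + q • v₂ + s • y)
        = F v₁ v₂ (p • v₁ + q • v₂ + w) := by
      intro s hs
      obtain ⟨g, hg, hgw, hfix⟩ := exists_transv_eq halt (v := w) (v' := s • y)
        (by simpa [hs] using hwy)
      have hy1' : ω y v₁ = 0 := by rw [← halt.neg, hy1, neg_zero]
      have hy2' : ω y v₂ = 0 := by rw [← halt.neg, hy2, neg_zero]
      have e1 : g v₁ = v₁ := hfix _ (by simp [hy1', hw1])
      have e2 : g v₂ = v₂ := hfix _ (by simp [hy2', hw2])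
      have := hinv' g hg v₁ v₂ (p • v₁ + q • v₂ + w)
      simpa only [map_add, map_smul, e1, e2, hgw] using this
    have hc := hcont v₁ 0 v₂ 0 (p • v₁ + q • v₂) y
    simp only [smul_zero, add_zero] at hc
    have := congrFun (hc.eq_of_eq_off_roots (continuous_const (y := F v₁ v₂
      (p • v₁ + q • v₂ + w))) Polynomial.X_ne_zero fun τ hτ => hmove τ (by simpa using hτ)) 0
    simpa using this.symm
  obtain ⟨P, -, hP⟩ := hpoly e f e f
  replace hP : ∀ τ, F e f (e + τ • f) = P.eval τ := hP
  have htorus : ∀ c, P.eval (4 * c) * 2 ^ m = 2 ^ (k + l) * P.eval c := by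
    intro c
    obtain ⟨g, hg, hge, hgf⟩ := exists_transv_pair halt hnd (v₁ := e) (v₂ := f)
      (w₁ := (2 : ℝ) • e) (w₂ := (2⁻¹ : ℝ) • f) (by simp [hef]) (by simp [hef])
    have h1 := hinv' g hg e f ((2⁻¹ : ℝ) • (e + (4 * c) • f))
    have h2 : g ((2⁻¹ : ℝ) • (e + (4 * c) • f)) = e + c • f := by
      simp only [map_add, map_smul, hge, hgf, smul_add, smul_smul]
      congr 2
      · norm_num
      · ring
    rw [h2, hge, hgf, hk _ two_ne_zero, hm _ (by norm_num), hl _ (by norm_num), hP, hP,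
      inv_pow, inv_pow] at h1
    have h2m : (2 : ℝ) ^ m ≠ 0 := by positivity
    have h2l : (2 : ℝ) ^ l ≠ 0 := by positivity
    field_simp at h1
    rw [pow_add]; linear_combination -h1
  obtain ⟨j, C, hj, hPC⟩ : ∃ j C, (C ≠ 0 → 2 * j + m = k + l) ∧ ∀ c, P.eval c = C * c ^ j := by
    have hcoeff : ∀ i, P.coeff i ≠ 0 → 2 * i + m = k + l := by
      intro i hi
      have h1 : P.comp (Polynomial.C 4 * Polynomial.X) * Polynomial.C (2 ^ m)
          = Polynomial.C (2 ^ (k + l)) * P := by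
        refine Polynomial.funext fun c => ?_
        simpa using htorus c
      have h2 := congrArg (fun R => Polynomial.coeff R i) h1
      simp only [Polynomial.coeff_mul_C, Polynomial.comp_C_mul_X_coeff,
        Polynomial.coeff_C_mul] at h2
      have h3 : (2 : ℝ) ^ (2 * i + m) = 2 ^ (k + l) := by
        apply mul_left_cancel₀ hi
        rw [pow_add, pow_mul]
        norm_num1
        linarith
      exact Nat.pow_right_injective le_rfl (by exact_mod_cast h3)
    by_cases h0 : P = 0
    · exact ⟨0, 0, by simp, by simp [h0]⟩
    refine ⟨P.natDegree, P.leadingCoeff, fun h => hcoeff _ h, fun c => ?_⟩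
    rw [Polynomial.eval_eq_sum_range, Finset.sum_range_succ, Finset.sum_eq_zero, zero_add]
    · rfl
    · intro i hi
      by_cases hi0 : P.coeff i = 0
      · rw [hi0, zero_mul]
      · have h1 := hcoeff i hi0
        have h2 := hcoeff _ (Polynomial.leadingCoeff_ne_zero.2 h0)
        have h3 := Finset.mem_range.1 hi
        omega
  have hplane : ∀ a b : ℝ, a ≠ 0 → a ^ j * F e f (a • e + b • f) = C * a ^ l * b ^ j := by
    intro a b ha
    have h1 : a • e + b • f = a • (e + (b / a) • f) := by
      rw [smul_add, smul_smul, mul_div_cancel₀ _ ha]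
    rw [h1, hl a ha, hP, hPC, div_pow]
    field_simp
  have hnormal : ∀ v₁ v₂ v₃, ω v₁ v₂ ≠ 0 → F v₁ v₂ v₃
      = ω v₁ v₂ ^ m * F e f ((-ω v₂ v₃ / ω v₁ v₂) • e + ω v₁ v₃ • f) := by
    intro v₁ v₂ v₃ h12
    obtain ⟨g, hg, hg1, hg2⟩ := exists_transv_pair halt hnd (w₁ := e) (w₂ := ω v₁ v₂ • f) h12
      (by simp [hef])
    have h13 : ω e (g v₃) = ω v₁ v₃ := by rw [← hg1, transvMonoid_preserves halt hg]
    have h23 : ω v₁ v₂ * ω f (g v₃) = ω v₂ v₃ := by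
      rw [← transvMonoid_preserves halt hg v₂, hg2]; simp
    have hf3 : ω f (g v₃) = ω v₂ v₃ / ω v₁ v₂ := by rw [← h23]; field_simp
    rw [← hinv' g hg v₁ v₂ v₃, hg1, hg2, hm _ h12]
    congr 1
    rw [← hproj e f ((-ω v₂ v₃ / ω v₁ v₂) • e + ω v₁ v₃ • f)
      (g v₃ - ((-ω v₂ v₃ / ω v₁ v₂) • e + ω v₁ v₃ • f)) (by simp [hef])
      (by simp [hef, h13, halt.self_eq_zero e])
      (by simp [hfe, hf3, halt.self_eq_zero f]; ring)
      (Submodule.mem_span_pair.2 ⟨_, _, rfl⟩), add_sub_cancel]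
  have hωcont : ∀ a a' b b' : E, Continuous fun τ : ℝ => ω (a + τ • a') (b + τ • b') := by
    intro a a' b b'
    simp only [map_add, map_smul, LinearMap.add_apply, LinearMap.smul_apply, smul_eq_mul]
    fun_prop
  have hzero : C = 0 → ∀ v₁ v₂ v₃, F v₁ v₂ v₃ = 0 := by
    intro hC
    refine eq_of_eq_generic halt hef hcont (fun _ _ _ _ _ _ => continuous_const) ?_
    intro v₁ v₂ v₃ h12 h23
    have ha : -ω v₂ v₃ / ω v₁ v₂ ≠ 0 := div_ne_zero (neg_ne_zero.2 h23) h12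
    have := hplane _ (ω v₁ v₃) ha
    rw [hC, zero_mul, zero_mul, mul_eq_zero, or_iff_right (pow_ne_zero _ ha)] at this
    rw [hnormal _ _ _ h12, this, mul_zero]
  by_cases hC : C = 0
  · exact Or.inl (hzero hC)
  have hj := hj hC
  have hjl : j ≤ l := by
    by_contra! hlt
    refine hC ?_
    have hc := hcont e 0 f 0 f e
    simp only [smul_zero, add_zero] at hc
    have := congrFun ((((continuous_id.pow (j - l)).mul hc).eq_of_eq_off_roots
      (continuous_const (y := C)) Polynomial.X_ne_zero) fun τ hτ => ?_) 0
    · simpa [Nat.sub_ne_zero_of_lt hlt] using this.symm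
    · have hτ : τ ≠ 0 := by simpa using hτ
      have h1 := hplane τ 1 hτ
      rw [one_smul, one_pow, mul_one, ← Nat.sub_add_cancel hlt.le, pow_add] at h1
      simp only [Pi.mul_apply]
      apply mul_left_cancel₀ (pow_ne_zero l hτ)
      rw [add_comm f]
      simp only [Pi.pow_apply, id]
      linarith
  obtain ⟨i, rfl⟩ := Nat.exists_eq_add_of_le hjl
  have hmain : ∀ v₁ v₂ v₃, ω v₁ v₂ ≠ 0 → ω v₂ v₃ ≠ 0 → ω v₁ v₂ ^ i * F v₁ v₂ v₃
      = C * (-1) ^ i * ω v₁ v₂ ^ m * ω v₁ v₃ ^ j * ω v₂ v₃ ^ i := by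
    intro v₁ v₂ v₃ h12 h23
    have ha : -ω v₂ v₃ / ω v₁ v₂ ≠ 0 := div_ne_zero (neg_ne_zero.2 h23) h12
    have h1 := hplane _ (ω v₁ v₃) ha
    rw [pow_add] at h1
    have h2 : F e f ((-ω v₂ v₃ / ω v₁ v₂) • e + ω v₁ v₃ • f)
        = C * (-ω v₂ v₃ / ω v₁ v₂) ^ i * ω v₁ v₃ ^ j := by
      apply mul_left_cancel₀ (pow_ne_zero j ha)
      rw [h1]; ring
    rw [hnormal _ _ _ h12, h2, div_pow, neg_pow]
    field_simp
  rcases le_or_gt i m with him | hmi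
  · obtain ⟨α, rfl⟩ := Nat.exists_eq_add_of_le him
    refine Or.inr ⟨α, j, i, C * (-1) ^ i, by omega, by omega, rfl, ?_⟩
    refine eq_of_eq_generic halt hef hcont (fun a a' b b' c c' => ?_) fun v₁ v₂ v₃ h12 h23 => ?_
    · exact ((continuous_const.mul ((hωcont _ _ _ _).pow _)).mul ((hωcont _ _ _ _).pow _)).mul
        ((hωcont _ _ _ _).pow _)
    · apply mul_left_cancel₀ (pow_ne_zero i h12)
      rw [hmain _ _ _ h12 h23, pow_add]; ring
  · refine absurd ?_ hC
    obtain ⟨d, rfl⟩ := Nat.exists_eq_add_of_lt hmi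
    have := eq_of_eq_generic halt hef
      (F := fun v₁ v₂ v₃ => ω v₁ v₂ ^ (d + 1) * F v₁ v₂ v₃)
      (G := fun v₁ v₂ v₃ => C * (-1) ^ (m + d + 1) * ω v₁ v₃ ^ j * ω v₂ v₃ ^ (m + d + 1))
      (fun a a' b b' c c' => ((hωcont _ _ _ _).pow _).mul (hcont _ _ _ _ _ _))
      (fun a a' b b' c c' => (continuous_const.mul ((hωcont _ _ _ _).pow _)).mul
        ((hωcont _ _ _ _).pow _))
      (fun v₁ v₂ v₃ h12 h23 => by
        apply mul_left_cancel₀ (pow_ne_zero m h12)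
        have := hmain _ _ _ h12 h23
        rw [add_assoc m, pow_add (ω v₁ v₂)] at this
        linear_combination this) e e f
    simpa [halt.self_eq_zero e, hef] using this.symm

end Symplectic

/-- The symplectic space `ℝ^{2n}` of pairs `(p, q)`. -/
abbrev SpE (n : ℕ) : Type := (Fin n → ℝ) × (Fin n → ℝ)

/-- The space `ℝ^{2n} × ℝ`, identified with `ℝ^{2n+1}` and with its dual. -/
abbrev CtW (n : ℕ) : Type := SpE n × ℝ

section Coordinates

variable {n : ℕ}

/-- The point of `ℝ^{2n+1}` with coordinates `p`, `q`, `t`. -/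
def assemble (p q : Fin n → ℝ) (t : ℝ) : Vc n := fun a =>
  if ha : a.1 < n then p ⟨a.1, ha⟩
  else if ha' : a.1 < 2 * n then q ⟨a.1 - n, by omega⟩ else t

@[simp] theorem assemble_p (p q : Fin n → ℝ) (t : ℝ) (i : Fin n) :
    assemble p q t (pIdx n i) = p i := by
  simp [assemble, pIdx]

@[simp] theorem assemble_q (p q : Fin n → ℝ) (t : ℝ) (i : Fin n) :
    assemble p q t (qIdx n i) = q i := by
  have := i.isLt
  have h : n + i.1 < 2 * n := by omega
  simp [assemble, qIdx, h]

@[simp] theorem assemble_t (p q : Fin n → ℝ) (t : ℝ) : assemble p q t (tIdx n) = t := by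
  have h : ¬ 2 * n < n := by omega
  simp [assemble, tIdx, h]

theorem idx_cases (a : Fin (2 * n + 1)) :
    (∃ i, a = pIdx n i) ∨ (∃ i, a = qIdx n i) ∨ a = tIdx n := by
  have := a.isLt
  by_cases h1 : a.1 < n
  · exact Or.inl ⟨⟨a.1, h1⟩, rfl⟩
  by_cases h2 : a.1 < 2 * n
  · refine Or.inr (Or.inl ⟨⟨a.1 - n, by omega⟩, Fin.ext ?_⟩)
    simp only [qIdx]; omega
  · refine Or.inr (Or.inr (Fin.ext ?_))
    simp only [tIdx]; omega

theorem Vc.ext_coords {x y : Vc n} (hp : ∀ i, x (pIdx n i) = y (pIdx n i))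
    (hq : ∀ i, x (qIdx n i) = y (qIdx n i)) (ht : x (tIdx n) = y (tIdx n)) : x = y := by
  funext a
  rcases idx_cases a with ⟨i, rfl⟩ | ⟨i, rfl⟩ | rfl
  exacts [hp i, hq i, ht]

theorem sum_coords (f : Fin (2 * n + 1) → ℝ) :
    ∑ a, f a = (∑ k, f (pIdx n k)) + (∑ k, f (qIdx n k)) + f (tIdx n) := by
  have e : 2 * n + 1 = (n + n) + 1 := by omega
  rw [← Equiv.sum_comp (finCongr e.symm) f, Fin.sum_univ_castSucc, Fin.sum_univ_add]
  congr 1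
  exact congrArg f (Fin.ext (by simp [tIdx]))

/-- The vector of `ℝ^{2n+1}` with components `(w.1.1, w.1.2, w.2)`. -/
def vecL (n : ℕ) : CtW n →L[ℝ] Vc n :=
  LinearMap.toContinuousLinearMap
    { toFun := fun w => assemble w.1.1 w.1.2 w.2
      map_add' := fun _ _ => Vc.ext_coords (by simp) (by simp) (by simp)
      map_smul' := fun _ _ => Vc.ext_coords (by simp) (by simp) (by simp) }

/-- The covector of `ℝ^{2n+1}` with components `(w.1.2, -w.1.1, w.2)`. -/
def covL (n : ℕ) : CtW n →L[ℝ] Vc n :=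
  LinearMap.toContinuousLinearMap
    { toFun := fun w => assemble w.1.2 (-w.1.1) w.2
      map_add' := fun _ _ => Vc.ext_coords (by simp) (by simp [add_comm]) (by simp)
      map_smul' := fun _ _ => Vc.ext_coords (by simp) (by simp) (by simp) }

theorem vecL_apply (w : CtW n) : vecL n w = assemble w.1.1 w.1.2 w.2 := rfl

theorem covL_apply (w : CtW n) : covL n w = assemble w.1.2 (-w.1.1) w.2 := rfl

theorem exists_vecL (x : Vc n) : ∃ w, vecL n w = x :=
  ⟨((fun i => x (pIdx n i), fun i => x (qIdx n i)), x (tIdx n)), by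
    rw [vecL_apply]; exact Vc.ext_coords (by simp) (by simp) (by simp)⟩

theorem exists_covL (x : Vc n) : ∃ w, covL n w = x :=
  ⟨((fun i => -x (qIdx n i), fun i => x (pIdx n i)), x (tIdx n)), by
    rw [covL_apply]; exact Vc.ext_coords (by simp) (by simp) (by simp)⟩

/-- The standard symplectic form on `ℝ^{2n}`. -/
def symp (n : ℕ) : SpE n →ₗ[ℝ] SpE n →ₗ[ℝ] ℝ :=
  LinearMap.mk₂ ℝ (fun u v => u.2 ⬝ᵥ v.1 - u.1 ⬝ᵥ v.2)
    (fun _ _ _ => by simp only [Prod.fst_add, Prod.snd_add, add_dotProduct]; ring)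
    (fun _ _ _ => by simp only [Prod.smul_fst, Prod.smul_snd, smul_dotProduct, smul_sub])
    (fun _ _ _ => by simp only [Prod.fst_add, Prod.snd_add, dotProduct_add]; ring)
    (fun _ _ _ => by simp only [Prod.smul_fst, Prod.smul_snd, dotProduct_smul, smul_sub])

theorem symp_apply (u v : SpE n) : symp n u v = u.2 ⬝ᵥ v.1 - u.1 ⬝ᵥ v.2 := rfl

theorem symp_isAlt : (symp n).IsAlt := fun v => by
  rw [symp_apply, dotProduct_comm, sub_self]

theorem symp_nondegenerate (v : SpE n) (hv : v ≠ 0) : ∃ w, symp n v w ≠ 0 := by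
  refine ⟨(v.2, -v.1), ?_⟩
  rw [symp_apply, dotProduct_neg, sub_neg_eq_add]
  intro h
  have h1 : 0 ≤ v.2 ⬝ᵥ v.2 := Finset.sum_nonneg fun i _ => mul_self_nonneg _
  have h2 : 0 ≤ v.1 ⬝ᵥ v.1 := Finset.sum_nonneg fun i _ => mul_self_nonneg _
  exact hv (Prod.ext (dotProduct_self_eq_zero.1 (by linarith))
    (dotProduct_self_eq_zero.1 (by linarith)))

theorem covL_dotProduct_vecL (a u : CtW n) :
    covL n a ⬝ᵥ vecL n u = symp n a.1 u.1 + a.2 * u.2 := by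
  rw [dotProduct, sum_coords, symp_apply, vecL_apply, covL_apply]
  simp [dotProduct, sub_eq_add_neg]

/-- A property of vectors of `ℝ^{2n}` that is stable under linear combinations and holds for the
Hamiltonian vectors of the coordinate functions holds everywhere. -/
theorem SpE.induction {p : SpE n → Prop} (h0 : p 0)
    (hadd : ∀ u v, p u → p v → p (u + v)) (hsmul : ∀ (c : ℝ) u, p u → p (c • u))
    (hp : ∀ i, p (0, Pi.single i 1))
    (hq : ∀ i, p (-Pi.single i 1, 0)) (u : SpE n) : p u := by
  have hu : u = ∑ i, (u.2 i • ((0, Pi.single i 1) : SpE n)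
      + (-u.1 i) • ((-Pi.single i 1, 0) : SpE n)) := by
    refine Prod.ext ?_ ?_ <;> funext j <;>
      simp [Prod.fst_sum, Prod.snd_sum, Finset.sum_apply, Pi.single_apply]
  rw [hu]
  exact Finset.sum_induction _ p (fun a b => hadd a b) h0 fun i _ =>
    hadd _ _ (hsmul _ _ (hp i)) (hsmul _ _ (hq i))

end Coordinates

section Action

variable {n : ℕ}

/-- The uncurried form of a function of four variables. -/
def uncurried {V : Type*} (Q : V → V → V → V → ℝ) (p : (V × V) × (V × V)) : ℝ :=
  Q p.1.1 p.1.2 p.2.1 p.2.2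

theorem clm_eq_sum (D : Vc n →L[ℝ] ℝ) (v : Vc n) : D v = ∑ i, v i * D (Pi.single i 1) := by
  conv_lhs => rw [← Finset.univ_sum_single v, map_sum]
  refine Finset.sum_congr rfl fun i _ => ?_
  rw [show (Pi.single i (v i) : Vc n) = v i • Pi.single i 1 by
    rw [← Pi.single_smul, smul_eq_mul, mul_one], map_smul, smul_eq_mul]

theorem LAct3_affine (ν : ℝ) (X₀ : Vc n) (J : Matrix (Fin (2 * n + 1)) (Fin (2 * n + 1)) ℝ)
    {Q : Vc n → Vc n → Vc n → Vc n → ℝ} (hQ : Differentiable ℝ (uncurried Q))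
    (x ξ η Y : Vc n) :
    LAct3 n ν (fun x => X₀ + J.mulVec x) Q x ξ η Y =
      fderiv ℝ (uncurried Q) ((x, ξ), (η, Y))
        ((X₀ + J.mulVec x, -J.vecMul ξ), (-J.vecMul η, J.mulVec Y))
        + ν * J.trace * Q x ξ η Y := by
  set D := fderiv ℝ (uncurried Q) ((x, ξ), (η, Y)) with hD
  have hd : HasFDerivAt (uncurried Q) D ((x, ξ), (η, Y)) := (hQ _).hasFDerivAt
  let i1 : Vc n →L[ℝ] (Vc n × Vc n) × (Vc n × Vc n) :=
    ((ContinuousLinearMap.id ℝ _).prod 0).prod 0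
  let i2 : Vc n →L[ℝ] (Vc n × Vc n) × (Vc n × Vc n) :=
    (ContinuousLinearMap.prod 0 (ContinuousLinearMap.id ℝ _)).prod 0
  let i3 : Vc n →L[ℝ] (Vc n × Vc n) × (Vc n × Vc n) :=
    ContinuousLinearMap.prod 0 ((ContinuousLinearMap.id ℝ _).prod 0)
  let i4 : Vc n →L[ℝ] (Vc n × Vc n) × (Vc n × Vc n) :=
    ContinuousLinearMap.prod 0 (ContinuousLinearMap.prod 0 (ContinuousLinearMap.id ℝ _))
  have e1 : ∀ i, pdX n i Q x ξ η Y = D.comp i1 (Pi.single i 1) := fun i => by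
    have h : HasFDerivAt (fun y : Vc n => ((y, ξ), (η, Y))) i1 x :=
      ((hasFDerivAt_id x).prodMk (hasFDerivAt_const ξ x)).prodMk (hasFDerivAt_const (η, Y) x)
    have hc : HasFDerivAt (fun y => Q y ξ η Y) (D.comp i1) x :=
      HasFDerivAt.comp (g := uncurried Q) x hd h
    exact congrArg (fun L : Vc n →L[ℝ] ℝ => L (Pi.single i 1)) hc.fderiv
  have e2 : ∀ i, pdXi n i Q x ξ η Y = D.comp i2 (Pi.single i 1) := fun i => by
    have h : HasFDerivAt (fun y : Vc n => ((x, y), (η, Y))) i2 ξ :=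
      ((hasFDerivAt_const x ξ).prodMk (hasFDerivAt_id ξ)).prodMk (hasFDerivAt_const (η, Y) ξ)
    have hc : HasFDerivAt (fun y => Q x y η Y) (D.comp i2) ξ :=
      HasFDerivAt.comp (g := uncurried Q) ξ hd h
    exact congrArg (fun L : Vc n →L[ℝ] ℝ => L (Pi.single i 1)) hc.fderiv
  have e3 : ∀ i, pdEta n i Q x ξ η Y = D.comp i3 (Pi.single i 1) := fun i => by
    have h : HasFDerivAt (fun y : Vc n => ((x, ξ), (y, Y))) i3 η :=
      (hasFDerivAt_const (x, ξ) η).prodMk ((hasFDerivAt_id η).prodMk (hasFDerivAt_const Y η))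
    have hc : HasFDerivAt (fun y => Q x ξ y Y) (D.comp i3) η :=
      HasFDerivAt.comp (g := uncurried Q) η hd h
    exact congrArg (fun L : Vc n →L[ℝ] ℝ => L (Pi.single i 1)) hc.fderiv
  have e4 : ∀ i, pdYv n i Q x ξ η Y = D.comp i4 (Pi.single i 1) := fun i => by
    have h : HasFDerivAt (fun y : Vc n => ((x, ξ), (η, y))) i4 Y :=
      (hasFDerivAt_const (x, ξ) Y).prodMk ((hasFDerivAt_const η Y).prodMk (hasFDerivAt_id Y))
    have hc : HasFDerivAt (fun y => Q x ξ η y) (D.comp i4) Y :=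
      HasFDerivAt.comp (g := uncurried Q) Y hd h
    exact congrArg (fun L : Vc n →L[ℝ] ℝ => L (Pi.single i 1)) hc.fderiv
  have eJ : ∀ i j, pd j (fun y : Vc n => (X₀ + J.mulVec y) i) x = J i j := fun i j => by
    have h : HasFDerivAt (fun y : Vc n => (X₀ + J.mulVec y) i)
        ((ContinuousLinearMap.proj i).comp (LinearMap.toContinuousLinearMap J.mulVecLin)) x := by
      have := ((LinearMap.toContinuousLinearMap J.mulVecLin).hasFDerivAt (x := x)).const_add X₀
      exact (hasFDerivAt_pi'.1 this) i
    have := congrArg (fun L : Vc n →L[ℝ] ℝ => L (Pi.single j 1)) h.fderiv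
    refine this.trans ?_
    simp
  have hsplit : ((X₀ + J.mulVec x, -J.vecMul ξ), (-J.vecMul η, J.mulVec Y))
      = i1 (X₀ + J.mulVec x) + i2 (-J.vecMul ξ) + i3 (-J.vecMul η) + i4 (J.mulVec Y) := by
    simp [i1, i2, i3, i4]
  have s1 : D (i1 (X₀ + J.mulVec x)) = _ := clm_eq_sum (D.comp i1) _
  have s2 : D (i2 (-J.vecMul ξ)) = _ := clm_eq_sum (D.comp i2) _
  have s3 : D (i3 (-J.vecMul η)) = _ := clm_eq_sum (D.comp i3) _
  have s4 : D (i4 (J.mulVec Y)) = _ := clm_eq_sum (D.comp i4) _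
  rw [hsplit, map_add, map_add, map_add, s1, s2, s3, s4]
  simp only [LAct3, e1, e2, e3, e4, eJ]
  have r2 : ∀ (ζ : Vc n) (L : Vc n →L[ℝ] ℝ), ∑ i, ∑ j, J i j * ζ i * L (Pi.single j 1)
      = -∑ i, (-J.vecMul ζ) i * L (Pi.single i 1) := by
    intro ζ L
    rw [Finset.sum_comm, ← Finset.sum_neg_distrib]
    refine Finset.sum_congr rfl fun j _ => ?_
    simp only [Pi.neg_apply, Matrix.vecMul, dotProduct, neg_mul, neg_neg, Finset.sum_mul]
    exact Finset.sum_congr rfl fun i _ => by ring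
  rw [r2, r2]
  have r4 : ∑ i, ∑ j, J i j * Y j * (D.comp i4) (Pi.single i 1)
      = ∑ i, (J.mulVec Y) i * (D.comp i4) (Pi.single i 1) := by
    refine Finset.sum_congr rfl fun i _ => ?_
    simp only [Matrix.mulVec, dotProduct, Finset.sum_mul]
  rw [r4, Matrix.trace]
  simp only [Matrix.diag]
  ring

end Action

section Hamiltonians

variable {n : ℕ}

theorem contactHam_p (h : Vc n → ℝ) (x : Vc n) (i : Fin n) :
    contactHam n h x (pIdx n i) = -pd (qIdx n i) h x - pd (tIdx n) h x * x (pIdx n i) := by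
  simp [contactHam, pIdx]

theorem contactHam_q (h : Vc n → ℝ) (x : Vc n) (i : Fin n) :
    contactHam n h x (qIdx n i) = pd (pIdx n i) h x - pd (tIdx n) h x * x (qIdx n i) := by
  have := i.isLt
  have h1 : n + i.1 < 2 * n := by omega
  simp [contactHam, qIdx, h1]

theorem contactHam_t (h : Vc n → ℝ) (x : Vc n) :
    contactHam n h x (tIdx n) = (∑ k : Fin n, (x (pIdx n k) * pd (pIdx n k) h x
      + x (qIdx n k) * pd (qIdx n k) h x)) - 2 * h x := by
  have h1 : ¬ 2 * n < n := by omega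
  simp [contactHam, tIdx, h1]

/-- The linear form on `ℝ^{2n+1}` with coefficient vector `a`. -/
def linForm (a : Vc n) : Vc n →L[ℝ] ℝ :=
  LinearMap.toContinuousLinearMap
    { toFun := fun x => a ⬝ᵥ x
      map_add' := fun _ _ => dotProduct_add _ _ _
      map_smul' := fun _ _ => dotProduct_smul _ _ _ }

theorem linForm_apply (a x : Vc n) : linForm a x = a ⬝ᵥ x := rfl

theorem hasFDerivAt_dotProduct (a x : Vc n) :
    HasFDerivAt (fun y : Vc n => a ⬝ᵥ y) (linForm a) x := (linForm a).hasFDerivAt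

theorem pd_dotProduct (a x : Vc n) (i : Fin (2 * n + 1)) :
    pd i (fun y : Vc n => a ⬝ᵥ y) x = a i := by
  rw [pd, (hasFDerivAt_dotProduct a x).fderiv, linForm_apply, dotProduct_single, mul_one]

theorem pd_dotProduct_mul (a b x : Vc n) (i : Fin (2 * n + 1)) :
    pd i (fun y : Vc n => (a ⬝ᵥ y) * (b ⬝ᵥ y)) x = (a ⬝ᵥ x) * b i + (b ⬝ᵥ x) * a i := by
  have h : HasFDerivAt (fun y : Vc n => (a ⬝ᵥ y) * (b ⬝ᵥ y)) _ x :=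
    (hasFDerivAt_dotProduct a x).mul (hasFDerivAt_dotProduct b x)
  rw [pd, h.fderiv]
  simp [linForm_apply]

theorem covL_dotProduct (u : SpE n) (x : Vc n) :
    covL n (u, 0) ⬝ᵥ x = ∑ k, (x (pIdx n k) * u.2 k + x (qIdx n k) * -u.1 k) := by
  rw [dotProduct, sum_coords, covL_apply, ← Finset.sum_add_distrib]
  simp [mul_comm]

theorem covL_zero_one_dotProduct (x : Vc n) : covL n (0, 1) ⬝ᵥ x = x (tIdx n) := by
  rw [dotProduct, sum_coords, covL_apply]
  simp

theorem contactHam_one :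
    contactHam n (fun _ => 1) = fun x => vecL n (0, -2) + (0 : Matrix _ _ ℝ).mulVec x := by
  funext x
  rw [Matrix.zero_mulVec, add_zero, vecL_apply]
  apply Vc.ext_coords <;> simp [contactHam_p, contactHam_q, contactHam_t, pd]

/-- The Jacobian of the contact dilation field. -/
def dilationMatrix (n : ℕ) : Matrix (Fin (2 * n + 1)) (Fin (2 * n + 1)) ℝ :=
  -1 - Matrix.vecMulVec (vecL n (0, 1)) (covL n (0, 1))

/-- The Jacobian of the contact Hamiltonian field of the linear form `ω(u,·)`. -/
def linMatrix (u : SpE n) : Matrix (Fin (2 * n + 1)) (Fin (2 * n + 1)) ℝ :=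
  -Matrix.vecMulVec (vecL n (0, 1)) (covL n (u, 0))

/-- The Jacobian of the contact Hamiltonian field of the quadratic form `ω(u,·)ω(u',·)`. -/
def quadMatrix (u u' : SpE n) : Matrix (Fin (2 * n + 1)) (Fin (2 * n + 1)) ℝ :=
  Matrix.vecMulVec (vecL n (u, 0)) (covL n (u', 0))
    + Matrix.vecMulVec (vecL n (u', 0)) (covL n (u, 0))

theorem contactHam_time :
    contactHam n (fun x => x (tIdx n)) = fun x => 0 + (dilationMatrix n).mulVec x := by
  funext x
  simp only [← covL_zero_one_dotProduct]
  rw [zero_add, dilationMatrix, Matrix.sub_mulVec, Matrix.neg_mulVec, Matrix.one_mulVec,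
    Matrix.vecMulVec_mulVec]
  apply Vc.ext_coords
  · simp [contactHam_p, pd_dotProduct, vecL_apply, covL_apply]
  · simp [contactHam_q, pd_dotProduct, vecL_apply, covL_apply]
  · simp only [contactHam_t, pd_dotProduct]
    rw [covL_zero_one_dotProduct]
    simp [vecL_apply, covL_apply]
    ring

theorem contactHam_linear (u : SpE n) :
    contactHam n (fun x => covL n (u, 0) ⬝ᵥ x) =
      fun x => vecL n (u, 0) + (linMatrix u).mulVec x := by
  funext x
  rw [linMatrix, Matrix.neg_mulVec, Matrix.vecMulVec_mulVec]
  apply Vc.ext_coords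
  · simp [contactHam_p, pd_dotProduct, vecL_apply, covL_apply]
  · simp [contactHam_q, pd_dotProduct, vecL_apply, covL_apply]
  · simp only [contactHam_t, pd_dotProduct]
    rw [covL_dotProduct]
    simp [vecL_apply, covL_apply]
    ring

theorem contactHam_quadratic (u u' : SpE n) :
    contactHam n (fun x => (covL n (u, 0) ⬝ᵥ x) * (covL n (u', 0) ⬝ᵥ x)) =
      fun x => 0 + (quadMatrix u u').mulVec x := by
  funext x
  rw [zero_add, quadMatrix, Matrix.add_mulVec, Matrix.vecMulVec_mulVec, Matrix.vecMulVec_mulVec]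
  apply Vc.ext_coords
  · simp [contactHam_p, pd_dotProduct_mul, vecL_apply, covL_apply]
  · simp [contactHam_q, pd_dotProduct_mul, vecL_apply, covL_apply]; intro i; ring
  · have h : ∀ v : SpE n, ∑ k, (x (pIdx n k) * covL n (v, 0) (pIdx n k)
        + x (qIdx n k) * covL n (v, 0) (qIdx n k)) = covL n (v, 0) ⬝ᵥ x := fun v => by
      rw [covL_dotProduct]; simp [covL_apply]
    simp only [contactHam_t, pd_dotProduct_mul]
    rw [Finset.sum_congr rfl (g := fun k => (covL n (u, 0) ⬝ᵥ x) * (x (pIdx n k)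
        * covL n (u', 0) (pIdx n k) + x (qIdx n k) * covL n (u', 0) (qIdx n k))
        + (covL n (u', 0) ⬝ᵥ x) * (x (pIdx n k)
        * covL n (u, 0) (pIdx n k) + x (qIdx n k) * covL n (u, 0) (qIdx n k)))
        fun k _ => by ring, Finset.sum_add_distrib, ← Finset.mul_sum, ← Finset.mul_sum, h, h]
    simp [vecL_apply]
    ring

end Hamiltonians

section Invariance

variable {n : ℕ}

/-- The expression of `Q` in the coordinates of `CtW n` on vectors and covectors. -/
def pulled (Q : Vc n → Vc n → Vc n → Vc n → ℝ) (z a b y : CtW n) : ℝ :=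
  Q (vecL n z) (covL n a) (covL n b) (vecL n y)

/-- The coordinate change in all four variables. -/
def coordMap (n : ℕ) :
    ((CtW n × CtW n) × (CtW n × CtW n)) →L[ℝ] (Vc n × Vc n) × (Vc n × Vc n) :=
  ((vecL n).prodMap (covL n)).prodMap ((covL n).prodMap (vecL n))

theorem coordMap_apply (z a b y : CtW n) :
    coordMap n ((z, a), (b, y)) = ((vecL n z, covL n a), (covL n b, vecL n y)) := rfl

theorem uncurried_pulled (Q : Vc n → Vc n → Vc n → Vc n → ℝ) :
    uncurried (pulled Q) = uncurried Q ∘ coordMap n := rfl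

theorem fderiv_pulled {Q : Vc n → Vc n → Vc n → Vc n → ℝ}
    (hQ : Differentiable ℝ (uncurried Q)) (p v) :
    fderiv ℝ (uncurried (pulled Q)) p v = fderiv ℝ (uncurried Q) (coordMap n p) (coordMap n v) := by
  rw [uncurried_pulled, ((hQ _).hasFDerivAt.comp p (coordMap n).hasFDerivAt).fderiv]
  rfl

/-- The prolongation of the field of a linear Hamiltonian. -/
def linDir (u : SpE n) (z a b y : CtW n) : (CtW n × CtW n) × (CtW n × CtW n) :=
  (((u, -symp n u z.1), (a.2 • u, 0)), ((b.2 • u, 0), (0, -symp n u y.1)))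

/-- The symmetric infinitesimal symplectic map attached to two vectors. -/
def quadMap (u w v : SpE n) : SpE n := symp n w v • u + symp n u v • w

/-- The prolongation of the field of a quadratic Hamiltonian. -/
def quadDir (u u' : SpE n) (z a b y : CtW n) : (CtW n × CtW n) × (CtW n × CtW n) :=
  (((quadMap u u' z.1, 0), (quadMap u u' a.1, 0)), ((quadMap u u' b.1, 0), (quadMap u u' y.1, 0)))

/-- The prolongation of the contact dilation field. -/
def dilDir (z a b y : CtW n) : (CtW n × CtW n) × (CtW n × CtW n) :=
  (((-z.1, -(2 * z.2)), (a.1, 2 * a.2)), ((b.1, 2 * b.2), (-y.1, -(2 * y.2))))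

/-- Infinitesimal invariance under the affine contact algebra, in the coordinates of `CtW n`. -/
structure Killed (ν : ℝ) (P : CtW n → CtW n → CtW n → CtW n → ℝ) : Prop where
  time : ∀ z a b y, fderiv ℝ (uncurried P) ((z, a), (b, y)) (((0, -2), 0), 0) = 0
  lin : ∀ u z a b y, fderiv ℝ (uncurried P) ((z, a), (b, y)) (linDir u z a b y) = 0
  quad : ∀ u u' z a b y, fderiv ℝ (uncurried P) ((z, a), (b, y)) (quadDir u u' z a b y) = 0
  dil : ∀ z a b y, fderiv ℝ (uncurried P) ((z, a), (b, y)) (dilDir z a b y)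
    = 2 * (((n : ℝ) + 1) * ν) * P z a b y

theorem covL_dotProduct_left (w : CtW n) (u : SpE n) :
    covL n w ⬝ᵥ vecL n (u, 0) = -symp n u w.1 := by
  rw [covL_dotProduct_vecL, mul_zero, add_zero, symp_isAlt.neg]

theorem covL_dotProduct_right (u : SpE n) (w : CtW n) :
    covL n (u, 0) ⬝ᵥ vecL n w = symp n u w.1 := by
  rw [covL_dotProduct_vecL, zero_mul, add_zero]

variable {ν : ℝ} {Q : Vc n → Vc n → Vc n → Vc n → ℝ}

theorem LAct3_one (hQ : Differentiable ℝ (uncurried Q)) (z a b y : CtW n) :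
    LAct3 n ν (contactHam n fun _ => 1) Q (vecL n z) (covL n a) (covL n b) (vecL n y)
      = fderiv ℝ (uncurried (pulled Q)) ((z, a), (b, y)) (((0, -2), 0), 0) := by
  rw [contactHam_one, LAct3_affine _ _ _ hQ, fderiv_pulled hQ,
    show ((((0, -2), 0), 0) : (CtW n × CtW n) × (CtW n × CtW n)) = (((0, -2), 0), (0, 0)) from rfl]
  simp [coordMap_apply]

theorem LAct3_linear (hQ : Differentiable ℝ (uncurried Q)) (u : SpE n) (z a b y : CtW n) :
    LAct3 n ν (contactHam n fun x => covL n (u, 0) ⬝ᵥ x) Q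
        (vecL n z) (covL n a) (covL n b) (vecL n y)
      = fderiv ℝ (uncurried (pulled Q)) ((z, a), (b, y)) (linDir u z a b y) := by
  have htr : (linMatrix u).trace = 0 := by
    rw [linMatrix, Matrix.trace_neg, Matrix.trace_vecMulVec, dotProduct_comm,
      covL_dotProduct_vecL]
    simp
  have hv : ∀ w : CtW n, (linMatrix u).mulVec (vecL n w) = vecL n (0, -symp n u w.1) := by
    intro w
    rw [linMatrix, Matrix.neg_mulVec, Matrix.vecMulVec_mulVec, covL_dotProduct_right,
      op_smul_eq_smul, ← map_smul, ← map_neg]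
    simp
  have hc : ∀ w : CtW n, -(linMatrix u).vecMul (covL n w) = covL n (w.2 • u, 0) := by
    intro w
    rw [linMatrix, Matrix.vecMul_neg, neg_neg, Matrix.vecMul_vecMulVec, covL_dotProduct_vecL,
      ← map_smul]
    simp
  rw [contactHam_linear, LAct3_affine _ _ _ hQ, fderiv_pulled hQ, htr, hv, hv, hc, hc, ← map_add]
  simp [coordMap, linDir]

theorem LAct3_quadratic (hQ : Differentiable ℝ (uncurried Q)) (u u' : SpE n) (z a b y : CtW n) :
    LAct3 n ν (contactHam n fun x => (covL n (u, 0) ⬝ᵥ x) * (covL n (u', 0) ⬝ᵥ x)) Q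
        (vecL n z) (covL n a) (covL n b) (vecL n y)
      = fderiv ℝ (uncurried (pulled Q)) ((z, a), (b, y)) (quadDir u u' z a b y) := by
  have htr : (quadMatrix u u').trace = 0 := by
    rw [quadMatrix, Matrix.trace_add, Matrix.trace_vecMulVec, Matrix.trace_vecMulVec,
      dotProduct_comm, dotProduct_comm (vecL n (u', 0)), covL_dotProduct_right,
      covL_dotProduct_right, ← symp_isAlt.neg u u', neg_add_cancel]
  have hv : ∀ w : CtW n, (quadMatrix u u').mulVec (vecL n w) = vecL n (quadMap u u' w.1, 0) := by
    intro w
    rw [quadMatrix, Matrix.add_mulVec, Matrix.vecMulVec_mulVec, Matrix.vecMulVec_mulVec,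
      covL_dotProduct_right, covL_dotProduct_right, op_smul_eq_smul, op_smul_eq_smul,
      ← map_smul, ← map_smul, ← map_add]
    simp [quadMap]
  have hc : ∀ w : CtW n, -(quadMatrix u u').vecMul (covL n w) = covL n (quadMap u u' w.1, 0) := by
    intro w
    rw [quadMatrix, Matrix.vecMul_add, Matrix.vecMul_vecMulVec, Matrix.vecMul_vecMulVec,
      covL_dotProduct_left, covL_dotProduct_left, ← map_smul, ← map_smul, ← map_add, ← map_neg]
    simp [quadMap]
  rw [contactHam_quadratic, LAct3_affine _ _ _ hQ, fderiv_pulled hQ, htr, hv, hv, hc, hc]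
  simp [coordMap, quadDir]

theorem LAct3_time (hQ : Differentiable ℝ (uncurried Q)) (z a b y : CtW n) :
    LAct3 n ν (contactHam n fun x => x (tIdx n)) Q
        (vecL n z) (covL n a) (covL n b) (vecL n y)
      = fderiv ℝ (uncurried (pulled Q)) ((z, a), (b, y)) (dilDir z a b y)
        - 2 * (((n : ℝ) + 1) * ν) * pulled Q z a b y := by
  have htr : (dilationMatrix n).trace = -(2 * ((n : ℝ) + 1)) := by
    rw [dilationMatrix, Matrix.trace_sub, Matrix.trace_neg, Matrix.trace_one,
      Matrix.trace_vecMulVec, dotProduct_comm, covL_dotProduct_vecL]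
    simp; ring
  have hv : ∀ w : CtW n, (dilationMatrix n).mulVec (vecL n w) = vecL n (-w.1, -(2 * w.2)) := by
    intro w
    rw [dilationMatrix, Matrix.sub_mulVec, Matrix.neg_mulVec, Matrix.one_mulVec,
      Matrix.vecMulVec_mulVec, covL_dotProduct_vecL, op_smul_eq_smul, ← map_smul, ← map_neg,
      ← map_sub]
    congr 1
    ext <;> simp; ring
  have hc : ∀ w : CtW n, -(dilationMatrix n).vecMul (covL n w) = covL n (w.1, 2 * w.2) := by
    intro w
    rw [dilationMatrix, Matrix.vecMul_sub, Matrix.vecMul_neg, Matrix.vecMul_one,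
      Matrix.vecMul_vecMulVec, covL_dotProduct_vecL, ← map_smul, ← map_neg, ← map_sub, ← map_neg]
    congr 1
    ext <;> simp; ring
  rw [contactHam_time, LAct3_affine _ _ _ hQ, fderiv_pulled hQ, htr, hv, hv, hc, hc, zero_add]
  simp only [coordMap_apply, dilDir, pulled]
  ring

theorem linDir_add (u v : SpE n) (z a b y : CtW n) :
    linDir (u + v) z a b y = linDir u z a b y + linDir v z a b y := by
  simp [linDir, add_comm]

theorem linDir_smul (c : ℝ) (u : SpE n) (z a b y : CtW n) :
    linDir (c • u) z a b y = c • linDir u z a b y := by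
  simp [linDir, smul_comm c]

theorem quadMap_comm (u u' v : SpE n) : quadMap u u' v = quadMap u' u v := add_comm _ _

theorem quadDir_comm (u u' : SpE n) (z a b y : CtW n) :
    quadDir u u' z a b y = quadDir u' u z a b y := by
  simp only [quadDir, quadMap_comm u u']

theorem quadDir_add (u v u' : SpE n) (z a b y : CtW n) :
    quadDir (u + v) u' z a b y = quadDir u u' z a b y + quadDir v u' z a b y := by
  have h : ∀ w, quadMap (u + v) u' w = quadMap u u' w + quadMap v u' w := fun w => by
    simp only [quadMap, map_add, LinearMap.add_apply]; module
  simp [quadDir, h]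

theorem quadDir_smul (c : ℝ) (u u' : SpE n) (z a b y : CtW n) :
    quadDir (c • u) u' z a b y = c • quadDir u u' z a b y := by
  have h : ∀ w, quadMap (c • u) u' w = c • quadMap u u' w := fun w => by
    simp only [quadMap, map_smul, LinearMap.smul_apply, smul_eq_mul]; module
  simp [quadDir, h]

theorem coord_p (i : Fin n) (x : Vc n) :
    x (pIdx n i) = covL n ((0, Pi.single i 1), 0) ⬝ᵥ x := by
  rw [covL_dotProduct]; simp [Pi.single_apply]

theorem coord_q (i : Fin n) (x : Vc n) :
    x (qIdx n i) = covL n ((-Pi.single i 1, 0), 0) ⬝ᵥ x := by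
  rw [covL_dotProduct]; simp [Pi.single_apply]

theorem invariant_iff_killed (hQ : Differentiable ℝ (uncurried Q)) :
    (∀ h, IsAffGen n h → ∀ x ξ η Y, LAct3 n ν (contactHam n h) Q x ξ η Y = 0)
      ↔ Killed ν (pulled Q) := by
  constructor
  · intro H
    refine ⟨fun z a b y => ?_, fun u z a b y => ?_, fun u u' z a b y => ?_, fun z a b y => ?_⟩
    · rw [← LAct3_one (ν := ν) hQ]
      exact H _ (Or.inl rfl) _ _ _ _
    · induction u using SpE.induction with
      | h0 =>
        simpa using congrArg (fderiv ℝ (uncurried (pulled Q)) ((z, a), (b, y)))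
          (linDir_smul 0 0 z a b y)
      | hadd u v hu hv => rw [linDir_add, map_add, hu, hv, add_zero]
      | hsmul c u hu => rw [linDir_smul, map_smul, hu, smul_zero]
      | hp i =>
        rw [← LAct3_linear (ν := ν) hQ]
        exact H _ (Or.inr (Or.inl ⟨i, funext fun x => (coord_p i x).symm⟩)) _ _ _ _
      | hq i =>
        rw [← LAct3_linear (ν := ν) hQ]
        exact H _ (Or.inr (Or.inr (Or.inl ⟨i, funext fun x => (coord_q i x).symm⟩))) _ _ _ _
    · have hz : ∀ u', fderiv ℝ (uncurried (pulled Q)) ((z, a), (b, y))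
          (quadDir 0 u' z a b y) = 0 := fun u' => by
        simpa using congrArg (fderiv ℝ (uncurried (pulled Q)) ((z, a), (b, y)))
          (quadDir_smul 0 0 u' z a b y)
      induction u using SpE.induction with
      | h0 => exact hz u'
      | hadd u v hu hv => rw [quadDir_add, map_add, hu, hv, add_zero]
      | hsmul c u hu => rw [quadDir_smul, map_smul, hu, smul_zero]
      | hp i =>
        rw [quadDir_comm]
        induction u' using SpE.induction with
        | h0 => exact hz _
        | hadd u v hu hv => rw [quadDir_add, map_add, hu, hv, add_zero]
        | hsmul c u hu => rw [quadDir_smul, map_smul, hu, smul_zero]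
        | hp j =>
          rw [← LAct3_quadratic (ν := ν) hQ]
          simp only [← coord_p]
          exact H _ (Or.inr (Or.inr (Or.inr (Or.inr (Or.inl ⟨_, _, rfl⟩))))) _ _ _ _
        | hq j =>
          rw [quadDir_comm, ← LAct3_quadratic (ν := ν) hQ]
          simp only [← coord_p, ← coord_q]
          exact H _ (by unfold IsAffGen; tauto) _ _ _ _
      | hq i =>
        rw [quadDir_comm]
        induction u' using SpE.induction with
        | h0 => exact hz _
        | hadd u v hu hv => rw [quadDir_add, map_add, hu, hv, add_zero]
        | hsmul c u hu => rw [quadDir_smul, map_smul, hu, smul_zero]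
        | hp j =>
          rw [← LAct3_quadratic (ν := ν) hQ]
          simp only [← coord_p, ← coord_q]
          exact H _ (by unfold IsAffGen; tauto) _ _ _ _
        | hq j =>
          rw [← LAct3_quadratic (ν := ν) hQ]
          simp only [← coord_q]
          exact H _ (Or.inr (Or.inr (Or.inr (Or.inr (Or.inr (Or.inl ⟨_, _, rfl⟩)))))) _ _ _ _
    · rw [← sub_eq_zero, ← LAct3_time (ν := ν) hQ]
      exact H _ (by unfold IsAffGen; tauto) _ _ _ _
  · intro H h hh x ξ η Y
    obtain ⟨z, rfl⟩ := exists_vecL x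
    obtain ⟨a, rfl⟩ := exists_covL ξ
    obtain ⟨b, rfl⟩ := exists_covL η
    obtain ⟨y, rfl⟩ := exists_vecL Y
    rcases hh with rfl | ⟨i, rfl⟩ | ⟨i, rfl⟩ | rfl | ⟨i, j, rfl⟩ | ⟨i, j, rfl⟩ | ⟨i, j, rfl⟩
    · rw [LAct3_one hQ, H.time]
    · simp only [coord_p]; rw [LAct3_linear hQ, H.lin]
    · simp only [coord_q]; rw [LAct3_linear hQ, H.lin]
    · rw [LAct3_time hQ, H.dil, sub_self]
    · simp only [coord_p]; rw [LAct3_quadratic hQ, H.quad]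
    · simp only [coord_q]; rw [LAct3_quadratic hQ, H.quad]
    · simp only [coord_p, coord_q]; rw [LAct3_quadratic hQ, H.quad]

end Invariance

section Transport

variable {n : ℕ}

theorem eq_exp_mul_of_fderiv_eq_mul {E : Type*} [NormedAddCommGroup E] [NormedSpace ℝ E]
    {F : E → ℝ} (hF : Differentiable ℝ F) {γ γ' : ℝ → E} (hγ : ∀ s, HasDerivAt γ (γ' s) s)
    {w : ℝ} (h : ∀ s, fderiv ℝ F (γ s) (γ' s) = w * F (γ s)) (s : ℝ) :
    F (γ s) = Real.exp (w * s) * F (γ 0) := by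
  have hd : ∀ s, HasDerivAt (fun s => Real.exp (-(w * s)) * F (γ s)) 0 s := fun s => by
    have h1 : HasDerivAt (fun s => F (γ s)) (w * F (γ s)) s := by
      have := (hF (γ s)).hasFDerivAt.comp_hasDerivAt s (hγ s)
      rwa [h s] at this
    have h2 : HasDerivAt (fun s => Real.exp (-(w * s))) (Real.exp (-(w * s)) * -(w * 1)) s :=
      (((hasDerivAt_id s).const_mul w).neg).exp
    refine (h2.mul h1).congr_deriv ?_
    ring
  have hc := is_const_of_deriv_eq_zero (fun s => (hd s).differentiableAt)
    (fun s => (hd s).deriv) s 0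
  simp only [mul_zero, neg_zero, Real.exp_zero, one_mul] at hc
  rw [← hc, ← mul_assoc, ← Real.exp_add, add_neg_cancel, Real.exp_zero, one_mul]

theorem hasDerivAt_line {E : Type*} [NormedAddCommGroup E] [NormedSpace ℝ E] (p v : E) (s : ℝ) :
    HasDerivAt (fun s : ℝ => p + s • v) v s := by
  simpa using ((hasDerivAt_id s).smul_const v).const_add p

theorem eq_of_fderiv_line_eq_zero {E : Type*} [NormedAddCommGroup E] [NormedSpace ℝ E]
    {F : E → ℝ} (hF : Differentiable ℝ F) {p v : E}
    (h : ∀ s : ℝ, fderiv ℝ F (p + s • v) v = 0) (s : ℝ) : F (p + s • v) = F p := by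
  simpa using eq_exp_mul_of_fderiv_eq_mul hF (hasDerivAt_line p v) (w := 0)
    (fun s => by rw [h s, zero_mul]) s

variable {ν : ℝ} {P : CtW n → CtW n → CtW n → CtW n → ℝ}

theorem Killed.time_indep (H : Killed ν P) (hP : Differentiable ℝ (uncurried P)) (u : SpE n)
    (t t' : ℝ) (a b y : CtW n) : P (u, t) a b y = P (u, t') a b y := by
  have h := eq_of_fderiv_line_eq_zero hP (p := (((u, t), a), (b, y)))
    (v := (((0, -2), 0), 0)) (fun s => H.time _ _ _ _) ((t - t') / 2)
  have e : ((((u, t), a), (b, y)) : (CtW n × CtW n) × (CtW n × CtW n))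
      + ((t - t') / 2) • (((0, -2), 0), 0) = (((u, t'), a), (b, y)) := by
    simp
  rw [e] at h
  exact h.symm

theorem Killed.eq_at_origin (H : Killed ν P) (hP : Differentiable ℝ (uncurried P))
    (z a b y : CtW n) :
    P z a b y = P 0 (a.1 - a.2 • z.1, a.2) (b.1 - b.2 • z.1, b.2) (y.1, y.2 + symp n z.1 y.1) := by
  obtain ⟨u, t⟩ := z
  rw [H.time_indep hP u t 0]
  have h := eq_of_fderiv_line_eq_zero hP (p := (((0, 0), (a.1 - a.2 • u, a.2)),
      ((b.1 - b.2 • u, b.2), (y.1, y.2 + symp n u y.1))))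
    (v := (((u, 0), (a.2 • u, 0)), ((b.2 • u, 0), (0, -symp n u y.1)))) (fun s => by
      have := H.lin u (s • u, 0) (a.1 - a.2 • u + s • a.2 • u, a.2)
        (b.1 - b.2 • u + s • b.2 • u, b.2) (y.1, y.2 + symp n u y.1 + s * -symp n u y.1)
      simpa [linDir, symp_isAlt.self_eq_zero] using this) 1
  have e : ((((0, 0), (a.1 - a.2 • u, a.2)),
      ((b.1 - b.2 • u, b.2), (y.1, y.2 + symp n u y.1))) : (CtW n × CtW n) × (CtW n × CtW n))
      + (1 : ℝ) • (((u, 0), (a.2 • u, 0)), ((b.2 • u, 0), (0, -symp n u y.1)))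
      = (((u, 0), a), (b, y)) := by
    simp
  rw [e] at h
  exact h

theorem Killed.eq_of_eq_at_origin {P' : CtW n → CtW n → CtW n → CtW n → ℝ} (H : Killed ν P)
    (hP : Differentiable ℝ (uncurried P)) (H' : Killed ν P')
    (hP' : Differentiable ℝ (uncurried P')) (h : ∀ a b y, P 0 a b y = P' 0 a b y) : P = P' := by
  funext z a b y
  rw [H.eq_at_origin hP, H'.eq_at_origin hP', h]

theorem Killed.transv_invariant (H : Killed ν P) (hP : Differentiable ℝ (uncurried P))
    (u : SpE n) (c : ℝ) (a b y : CtW n) :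
    P 0 (transv (symp n) u c a.1, a.2) (transv (symp n) u c b.1, b.2)
      (transv (symp n) u c y.1, y.2) = P 0 a b y := by
  have hq : ∀ (v : SpE n) (s : ℝ), quadMap u u (v + s • ((2 * symp n u v) • u))
      = (2 * symp n u v) • u := fun v s => by
    simp only [quadMap, map_add, map_smul, symp_isAlt.self_eq_zero, smul_zero, add_zero, two_mul,
      add_smul]
  have h := eq_of_fderiv_line_eq_zero hP (p := ((0, a), (b, y)))
    (v := ((0, ((2 * symp n u a.1) • u, 0)),
      (((2 * symp n u b.1) • u, 0), ((2 * symp n u y.1) • u, 0)))) (fun s => by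
      have := H.quad u u 0 (a.1 + s • ((2 * symp n u a.1) • u), a.2)
        (b.1 + s • ((2 * symp n u b.1) • u), b.2) (y.1 + s • ((2 * symp n u y.1) • u), y.2)
      have h0 : quadMap u u (0 : SpE n) = 0 := by simp [quadMap]
      have hv : ∀ (v : CtW n) (w : SpE n), v + (w, 0) = (v.1 + w, v.2) := fun v w =>
        Prod.ext rfl (add_zero _)
      simp only [quadDir, hq, Prod.fst_zero, h0] at this
      simp only [Prod.mk_add_mk, Prod.smul_mk, smul_zero, add_zero, hv]
      exact this) (c / 2)
  have ht : ∀ v : CtW n, v + (c / 2) • (((2 * symp n u v.1) • u, 0) : CtW n)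
      = (transv (symp n) u c v.1, v.2) := fun v => by
    refine Prod.ext ?_ ?_
    · simp only [Prod.fst_add, Prod.smul_fst, transv_apply, smul_smul]
      congr 2; ring
    · simp
  have e : (((0, a), (b, y)) : (CtW n × CtW n) × (CtW n × CtW n)) + (c / 2) •
      ((0, ((2 * symp n u a.1) • u, 0)),
      (((2 * symp n u b.1) • u, 0), ((2 * symp n u y.1) • u, 0)))
      = ((0, (transv (symp n) u c a.1, a.2)), ((transv (symp n) u c b.1, b.2),
        (transv (symp n) u c y.1, y.2))) := by
    rw [← ht, ← ht, ← ht]; simp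
  rw [e] at h
  exact h

theorem Killed.dilation (H : Killed ν P) (hP : Differentiable ℝ (uncurried P))
    (s : ℝ) (a b y : CtW n) :
    P 0 (Real.exp s • a.1, Real.exp (2 * s) * a.2) (Real.exp s • b.1, Real.exp (2 * s) * b.2)
      (Real.exp (-s) • y.1, Real.exp (-(2 * s)) * y.2)
      = Real.exp (2 * (((n : ℝ) + 1) * ν) * s) * P 0 a b y := by
  have hexp : ∀ (c s : ℝ), HasDerivAt (fun s => Real.exp (c * s)) (c * Real.exp (c * s)) s :=
    fun c s => by simpa [mul_comm] using ((hasDerivAt_id s).const_mul c).exp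
  have hw : ∀ (c : ℝ) (v : CtW n) (s : ℝ), HasDerivAt
      (fun s => ((Real.exp (c * s) • v.1, Real.exp ((2 * c) * s) * v.2) : CtW n))
      (c • (Real.exp (c * s) • v.1), (2 * c) * (Real.exp ((2 * c) * s) * v.2)) s := fun c v s => by
    have h1 := (hexp c s).smul_const v.1
    have h2 := (hexp (2 * c) s).mul_const v.2
    rw [← smul_smul, mul_assoc (2 * c)] at *
    exact h1.prodMk h2
  have hγ := fun s => ((hasDerivAt_const s (0 : CtW n)).prodMk (hw 1 a s)).prodMk
    ((hw 1 b s).prodMk (hw (-1) y s))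
  have h := eq_exp_mul_of_fderiv_eq_mul hP hγ (w := 2 * (((n : ℝ) + 1) * ν)) (fun s => by
    have := H.dil 0 (Real.exp (1 * s) • a.1, Real.exp ((2 * 1) * s) * a.2)
      (Real.exp (1 * s) • b.1, Real.exp ((2 * 1) * s) * b.2)
      (Real.exp (-1 * s) • y.1, Real.exp ((2 * -1) * s) * y.2)
    rw [uncurried, ← this]
    congr 1
    simp [dilDir]
    rfl) s
  simpa [uncurried] using h

end Transport

section Generators

variable {n : ℕ}

theorem hasDerivAt_symp {f g : ℝ → SpE n} {f' g' : SpE n} {s : ℝ} (hf : HasDerivAt f f' s)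
    (hg : HasDerivAt g g' s) :
    HasDerivAt (fun s => symp n (f s) (g s)) (symp n (f s) g' + symp n f' (g s)) s :=
  (symp n).toContinuousBilinearMap.hasDerivAt_of_bilinear (fun _ => hf) fun _ => hg

theorem fderiv_eq_of_line {E : Type*} [NormedAddCommGroup E] [NormedSpace ℝ E] {F : E → ℝ}
    (hF : Differentiable ℝ F) {p v : E} {d : ℝ}
    (h : HasDerivAt (fun s : ℝ => F (p + s • v)) d 0) : fderiv ℝ F p v = d := by
  have h1 := (hF (p + (0 : ℝ) • v)).hasFDerivAt.comp_hasDerivAt (0 : ℝ) (hasDerivAt_line p v 0)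
  have h2 := h1.unique h
  rwa [zero_smul, add_zero] at h2

theorem pulled_u1 (z a b y : CtW n) :
    pulled (u1 n) z a b y = symp n a.1 y.1 + a.2 * y.2 := by
  rw [← covL_dotProduct_vecL, dotProduct_comm]; rfl

theorem pulled_u2 (z a b y : CtW n) :
    pulled (u2 n) z a b y = symp n b.1 y.1 + b.2 * y.2 := by
  rw [← covL_dotProduct_vecL, dotProduct_comm]; rfl

theorem pulled_u3 (z a b y : CtW n) :
    pulled (u3 n) z a b y = -(1 / 2) * (symp n z.1 y.1 + y.2) := by
  simp only [pulled, u3, vecL_apply, assemble_p, assemble_q, assemble_t, symp_apply, dotProduct,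
    Finset.sum_sub_distrib]
  ring

theorem pulled_u4 (z a b y : CtW n) : pulled (u4 n) z a b y = -2 * a.2 := by
  simp only [pulled, u4, covL_apply, assemble_t]

theorem pulled_u5 (z a b y : CtW n) : pulled (u5 n) z a b y = -2 * b.2 := by
  simp only [pulled, u5, covL_apply, assemble_t]

theorem pulled_L1p (z a b y : CtW n) :
    pulled (L1p n) z a b y
      = -symp n a.1 b.1 + b.2 * symp n a.1 z.1 - a.2 * symp n b.1 z.1 := by
  simp only [pulled, L1p, vecL_apply, covL_apply, assemble_p, assemble_q, assemble_t, symp_apply,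
    dotProduct, Finset.sum_sub_distrib, Finset.sum_add_distrib, Pi.neg_apply, mul_neg, neg_mul,
    Finset.sum_neg_distrib]
  simp only [mul_comm]
  ring

theorem differentiable_uncurried_u1 : Differentiable ℝ (uncurried (u1 n)) := by
  unfold uncurried u1; fun_prop

theorem differentiable_uncurried_u2 : Differentiable ℝ (uncurried (u2 n)) := by
  unfold uncurried u2; fun_prop

theorem differentiable_uncurried_u3 : Differentiable ℝ (uncurried (u3 n)) := by
  unfold uncurried u3; fun_prop

theorem differentiable_uncurried_u4 : Differentiable ℝ (uncurried (u4 n)) := by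
  unfold uncurried u4; fun_prop

theorem differentiable_uncurried_u5 : Differentiable ℝ (uncurried (u5 n)) := by
  unfold uncurried u5; fun_prop

theorem differentiable_uncurried_L1p : Differentiable ℝ (uncurried (L1p n)) := by
  unfold uncurried L1p; fun_prop

theorem Differentiable.pulled {Q : Vc n → Vc n → Vc n → Vc n → ℝ}
    (hQ : Differentiable ℝ (uncurried Q)) : Differentiable ℝ (uncurried (pulled Q)) := by
  rw [uncurried_pulled]
  exact hQ.comp (coordMap n).differentiable

theorem fderiv_pulled_u1 (z a b y z' a' b' y' : CtW n) :
    fderiv ℝ (uncurried (pulled (u1 n))) ((z, a), (b, y)) ((z', a'), (b', y'))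
      = symp n a.1 y'.1 + symp n a'.1 y.1 + (a'.2 * y.2 + a.2 * y'.2) := by
  refine fderiv_eq_of_line differentiable_uncurried_u1.pulled ?_
  have h := (hasDerivAt_symp (hasDerivAt_line a.1 a'.1 0) (hasDerivAt_line y.1 y'.1 0)).add
    ((hasDerivAt_line a.2 a'.2 0).mul (hasDerivAt_line y.2 y'.2 0))
  simp only [zero_smul, add_zero] at h
  exact h.congr_of_eventuallyEq (.of_forall fun s => pulled_u1 _ _ _ _)

theorem fderiv_pulled_u2 (z a b y z' a' b' y' : CtW n) :
    fderiv ℝ (uncurried (pulled (u2 n))) ((z, a), (b, y)) ((z', a'), (b', y'))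
      = symp n b.1 y'.1 + symp n b'.1 y.1 + (b'.2 * y.2 + b.2 * y'.2) := by
  refine fderiv_eq_of_line differentiable_uncurried_u2.pulled ?_
  have h := (hasDerivAt_symp (hasDerivAt_line b.1 b'.1 0) (hasDerivAt_line y.1 y'.1 0)).add
    ((hasDerivAt_line b.2 b'.2 0).mul (hasDerivAt_line y.2 y'.2 0))
  simp only [zero_smul, add_zero] at h
  exact h.congr_of_eventuallyEq (.of_forall fun s => pulled_u2 _ _ _ _)

theorem fderiv_pulled_u3 (z a b y z' a' b' y' : CtW n) :
    fderiv ℝ (uncurried (pulled (u3 n))) ((z, a), (b, y)) ((z', a'), (b', y'))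
      = -(1 / 2) * (symp n z.1 y'.1 + symp n z'.1 y.1 + y'.2) := by
  refine fderiv_eq_of_line differentiable_uncurried_u3.pulled ?_
  have h := ((hasDerivAt_symp (hasDerivAt_line z.1 z'.1 0) (hasDerivAt_line y.1 y'.1 0)).add
    (hasDerivAt_line y.2 y'.2 0)).const_mul (-(1 / 2) : ℝ)
  simp only [zero_smul, add_zero] at h
  exact h.congr_of_eventuallyEq (.of_forall fun s => pulled_u3 _ _ _ _)

theorem fderiv_pulled_u4 (z a b y z' a' b' y' : CtW n) :
    fderiv ℝ (uncurried (pulled (u4 n))) ((z, a), (b, y)) ((z', a'), (b', y')) = -2 * a'.2 := by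
  refine fderiv_eq_of_line differentiable_uncurried_u4.pulled ?_
  exact ((hasDerivAt_line a.2 a'.2 0).const_mul (-2 : ℝ)).congr_of_eventuallyEq
    (.of_forall fun s => pulled_u4 _ _ _ _)

theorem fderiv_pulled_u5 (z a b y z' a' b' y' : CtW n) :
    fderiv ℝ (uncurried (pulled (u5 n))) ((z, a), (b, y)) ((z', a'), (b', y')) = -2 * b'.2 := by
  refine fderiv_eq_of_line differentiable_uncurried_u5.pulled ?_
  exact ((hasDerivAt_line b.2 b'.2 0).const_mul (-2 : ℝ)).congr_of_eventuallyEq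
    (.of_forall fun s => pulled_u5 _ _ _ _)

theorem fderiv_pulled_L1p (z a b y z' a' b' y' : CtW n) :
    fderiv ℝ (uncurried (pulled (L1p n))) ((z, a), (b, y)) ((z', a'), (b', y'))
      = -(symp n a.1 b'.1 + symp n a'.1 b.1)
        + (b'.2 * symp n a.1 z.1 + b.2 * (symp n a.1 z'.1 + symp n a'.1 z.1))
        - (a'.2 * symp n b.1 z.1 + a.2 * (symp n b.1 z'.1 + symp n b'.1 z.1)) := by
  refine fderiv_eq_of_line differentiable_uncurried_L1p.pulled ?_
  have hz := hasDerivAt_line z.1 z'.1 0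
  have ha := hasDerivAt_line a.1 a'.1 0
  have hb := hasDerivAt_line b.1 b'.1 0
  have h := ((hasDerivAt_symp ha hb).neg.add
    ((hasDerivAt_line b.2 b'.2 0).mul (hasDerivAt_symp ha hz))).sub
    ((hasDerivAt_line a.2 a'.2 0).mul (hasDerivAt_symp hb hz))
  simp only [zero_smul, add_zero] at h
  exact h.congr_of_eventuallyEq (.of_forall fun s => pulled_L1p _ _ _ _)

theorem symp_quadMap (u u' v w : SpE n) :
    symp n (quadMap u u' v) w = -symp n v (quadMap u u' w) := by
  simp only [quadMap, map_add, map_smul, LinearMap.add_apply, smul_eq_mul,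
    LinearMap.smul_apply, ← symp_isAlt.neg v]
  ring

theorem killed_u1 : Killed 0 (pulled (u1 n)) where
  time z a b y := by rw [show ((((0, -2), 0), 0) : (CtW n × CtW n) × (CtW n × CtW n))
    = (((0, -2), 0), (0, 0)) from rfl, fderiv_pulled_u1]; simp
  lin u z a b y := by rw [linDir, fderiv_pulled_u1]; simp
  quad u u' z a b y := by rw [quadDir, fderiv_pulled_u1]; simp [symp_quadMap]
  dil z a b y := by rw [dilDir, fderiv_pulled_u1]; simp; ring

theorem killed_u2 : Killed 0 (pulled (u2 n)) where
  time z a b y := by rw [show ((((0, -2), 0), 0) : (CtW n × CtW n) × (CtW n × CtW n))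
    = (((0, -2), 0), (0, 0)) from rfl, fderiv_pulled_u2]; simp
  lin u z a b y := by rw [linDir, fderiv_pulled_u2]; simp
  quad u u' z a b y := by rw [quadDir, fderiv_pulled_u2]; simp [symp_quadMap]
  dil z a b y := by rw [dilDir, fderiv_pulled_u2]; simp; ring

theorem killed_u3 : Killed (-(1 / ((n : ℝ) + 1))) (pulled (u3 n)) where
  time z a b y := by rw [show ((((0, -2), 0), 0) : (CtW n × CtW n) × (CtW n × CtW n))
    = (((0, -2), 0), (0, 0)) from rfl, fderiv_pulled_u3]; simp
  lin u z a b y := by rw [linDir, fderiv_pulled_u3]; simp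
  quad u u' z a b y := by rw [quadDir, fderiv_pulled_u3]; simp [symp_quadMap]
  dil z a b y := by
    have : (n : ℝ) + 1 ≠ 0 := by positivity
    rw [dilDir, fderiv_pulled_u3, pulled_u3]; simp; field_simp; ring

theorem killed_u4 : Killed (1 / ((n : ℝ) + 1)) (pulled (u4 n)) where
  time z a b y := by rw [show ((((0, -2), 0), 0) : (CtW n × CtW n) × (CtW n × CtW n))
    = (((0, -2), 0), (0, 0)) from rfl, fderiv_pulled_u4]; simp
  lin u z a b y := by rw [linDir, fderiv_pulled_u4]; simp
  quad u u' z a b y := by rw [quadDir, fderiv_pulled_u4]; simp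
  dil z a b y := by
    have : (n : ℝ) + 1 ≠ 0 := by positivity
    rw [dilDir, fderiv_pulled_u4, pulled_u4]; field_simp

theorem killed_u5 : Killed (1 / ((n : ℝ) + 1)) (pulled (u5 n)) where
  time z a b y := by rw [show ((((0, -2), 0), 0) : (CtW n × CtW n) × (CtW n × CtW n))
    = (((0, -2), 0), (0, 0)) from rfl, fderiv_pulled_u5]; simp
  lin u z a b y := by rw [linDir, fderiv_pulled_u5]; simp
  quad u u' z a b y := by rw [quadDir, fderiv_pulled_u5]; simp
  dil z a b y := by
    have : (n : ℝ) + 1 ≠ 0 := by positivity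
    rw [dilDir, fderiv_pulled_u5, pulled_u5]; field_simp

theorem killed_L1p : Killed (1 / ((n : ℝ) + 1)) (pulled (L1p n)) where
  time z a b y := by rw [show ((((0, -2), 0), 0) : (CtW n × CtW n) × (CtW n × CtW n))
    = (((0, -2), 0), (0, 0)) from rfl, fderiv_pulled_L1p]; simp
  lin u z a b y := by
    rw [linDir, fderiv_pulled_L1p, ← symp_isAlt.neg u b.1]; simp; ring
  quad u u' z a b y := by rw [quadDir, fderiv_pulled_L1p]; simp [symp_quadMap]
  dil z a b y := by
    have : (n : ℝ) + 1 ≠ 0 := by positivity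
    rw [dilDir, fderiv_pulled_L1p, pulled_L1p]; simp; field_simp; ring

end Generators

section SemiInvariants

variable {n : ℕ}

/-- Differentiable functions satisfying the infinitesimal invariance conditions. -/
def SemiInv (ν : ℝ) (P : CtW n → CtW n → CtW n → CtW n → ℝ) : Prop :=
  Differentiable ℝ (uncurried P) ∧ Killed ν P

variable {ν ν' : ℝ} {P P' : CtW n → CtW n → CtW n → CtW n → ℝ}

theorem SemiInv.mul (h : SemiInv ν P) (h' : SemiInv ν' P') : SemiInv (ν + ν') (P * P') := by
  have e : ∀ p v, fderiv ℝ (uncurried (P * P')) p v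
      = uncurried P p * fderiv ℝ (uncurried P') p v
        + uncurried P' p * fderiv ℝ (uncurried P) p v := fun p v => by
    have : HasFDerivAt (uncurried (P * P')) _ p := (h.1 p).hasFDerivAt.mul (h'.1 p).hasFDerivAt
    rw [this.fderiv]; rfl
  refine ⟨h.1.mul h'.1, ⟨fun z a b y => ?_, fun u z a b y => ?_, fun u u' z a b y => ?_,
    fun z a b y => ?_⟩⟩
  · rw [e, h.2.time, h'.2.time]; ring
  · rw [e, h.2.lin, h'.2.lin]; ring
  · rw [e, h.2.quad, h'.2.quad]; ring
  · rw [e, h.2.dil, h'.2.dil]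
    simp only [uncurried, Pi.mul_apply]
    ring

theorem SemiInv.one : SemiInv 0 (1 : CtW n → CtW n → CtW n → CtW n → ℝ) := by
  have e : ∀ p, fderiv ℝ (uncurried (1 : CtW n → CtW n → CtW n → CtW n → ℝ)) p = 0 := fun p =>
    (hasFDerivAt_const (1 : ℝ) p).fderiv
  refine ⟨differentiable_const (1 : ℝ), ⟨fun z a b y => ?_, fun u z a b y => ?_,
    fun u u' z a b y => ?_, fun z a b y => ?_⟩⟩ <;> rw [e] <;> simp

theorem SemiInv.zero : SemiInv ν (0 : CtW n → CtW n → CtW n → CtW n → ℝ) := by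
  have e : ∀ p, fderiv ℝ (uncurried (0 : CtW n → CtW n → CtW n → CtW n → ℝ)) p = 0 := fun p =>
    (hasFDerivAt_const (0 : ℝ) p).fderiv
  refine ⟨differentiable_const (0 : ℝ), ⟨fun z a b y => ?_, fun u z a b y => ?_,
    fun u u' z a b y => ?_, fun z a b y => ?_⟩⟩ <;> rw [e] <;> simp

theorem SemiInv.add (h : SemiInv ν P) (h' : SemiInv ν P') : SemiInv ν (P + P') := by
  have e : ∀ p v, fderiv ℝ (uncurried (P + P')) p v
      = fderiv ℝ (uncurried P) p v + fderiv ℝ (uncurried P') p v := fun p v => by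
    have : HasFDerivAt (uncurried (P + P')) _ p := (h.1 p).hasFDerivAt.add (h'.1 p).hasFDerivAt
    rw [this.fderiv]; rfl
  refine ⟨h.1.add h'.1, ⟨fun z a b y => ?_, fun u z a b y => ?_, fun u u' z a b y => ?_,
    fun z a b y => ?_⟩⟩
  · rw [e, h.2.time, h'.2.time, add_zero]
  · rw [e, h.2.lin, h'.2.lin, add_zero]
  · rw [e, h.2.quad, h'.2.quad, add_zero]
  · rw [e, h.2.dil, h'.2.dil, ← mul_add]; rfl

theorem SemiInv.const_smul (c : ℝ) (h : SemiInv ν P) : SemiInv ν (c • P) := by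
  have e : ∀ p v, fderiv ℝ (uncurried (c • P)) p v = c * fderiv ℝ (uncurried P) p v :=
    fun p v => by
      have : HasFDerivAt (uncurried (c • P)) _ p := (h.1 p).hasFDerivAt.const_smul c
      rw [this.fderiv]; rfl
  refine ⟨h.1.const_smul c, ⟨fun z a b y => ?_, fun u z a b y => ?_, fun u u' z a b y => ?_,
    fun z a b y => ?_⟩⟩
  · rw [e, h.2.time, mul_zero]
  · rw [e, h.2.lin, mul_zero]
  · rw [e, h.2.quad, mul_zero]
  · rw [e, h.2.dil, mul_left_comm]; rfl

theorem SemiInv.sum {ι : Type*} {s : Finset ι} {F : ι → CtW n → CtW n → CtW n → CtW n → ℝ}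
    (h : ∀ i ∈ s, SemiInv ν (F i)) : SemiInv ν (∑ i ∈ s, F i) :=
  Finset.sum_induction _ _ (fun _ _ => SemiInv.add) SemiInv.zero h

theorem SemiInv.pow (h : SemiInv ν P) (j : ℕ) : SemiInv (j * ν) (P ^ j) := by
  induction j with
  | zero => simpa using SemiInv.one
  | succ j ih =>
    have := ih.mul h
    rwa [← pow_succ, show (j : ℝ) * ν + ν = ((j + 1 : ℕ) : ℝ) * ν by push_cast; ring] at this

/-- The monomials in the distinguished invariants. -/
def invMonomial (n a b c d e f : ℕ) (x ξ η Y : Vc n) : ℝ :=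
  u1 n x ξ η Y ^ a * u2 n x ξ η Y ^ b * u3 n x ξ η Y ^ c
    * u4 n x ξ η Y ^ d * u5 n x ξ η Y ^ e * L1p n x ξ η Y ^ f

theorem semiInv_invMonomial (a b c d e f : ℕ)
    (h : (d : ℝ) + (e : ℝ) + (f : ℝ) - (c : ℝ) = ((n : ℝ) + 1) * ν) :
    SemiInv ν (pulled (invMonomial n a b c d e f)) := by
  have h1 : SemiInv 0 (pulled (u1 n)) := ⟨differentiable_uncurried_u1.pulled, killed_u1⟩
  have h2 : SemiInv 0 (pulled (u2 n)) := ⟨differentiable_uncurried_u2.pulled, killed_u2⟩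
  have h3 : SemiInv _ (pulled (u3 n)) := ⟨differentiable_uncurried_u3.pulled, killed_u3⟩
  have h4 : SemiInv _ (pulled (u4 n)) := ⟨differentiable_uncurried_u4.pulled, killed_u4⟩
  have h5 : SemiInv _ (pulled (u5 n)) := ⟨differentiable_uncurried_u5.pulled, killed_u5⟩
  have h6 : SemiInv _ (pulled (L1p n)) := ⟨differentiable_uncurried_L1p.pulled, killed_L1p⟩
  have H := (((((h1.pow a).mul (h2.pow b)).mul (h3.pow c)).mul (h4.pow d)).mul (h5.pow e)).mul
    (h6.pow f)
  have hn : (n : ℝ) + 1 ≠ 0 := by positivity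
  have hw : (a : ℝ) * 0 + b * 0 + c * -(1 / ((n : ℝ) + 1)) + d * (1 / ((n : ℝ) + 1))
      + e * (1 / ((n : ℝ) + 1)) + f * (1 / ((n : ℝ) + 1)) = ν := by
    field_simp
    linarith
  rw [hw] at H
  exact H

/-- Combinations of the monomials in the distinguished invariants. -/
def invComb (n k m l : ℕ) (co : ℕ → ℕ → ℕ → ℕ → ℕ → ℕ → ℝ) (x ξ η Y : Vc n) : ℝ :=
  ∑ a ∈ Finset.range (k + 1), ∑ b ∈ Finset.range (m + 1), ∑ c ∈ Finset.range (l + 1),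
    ∑ d ∈ Finset.range (k + 1), ∑ e ∈ Finset.range (m + 1), ∑ f ∈ Finset.range (k + 1),
      co a b c d e f * invMonomial n a b c d e f x ξ η Y

/-- The coefficients are supported on the exponents of the given degrees and weight. -/
def Admissible (n k m l : ℕ) (ν : ℝ) (co : ℕ → ℕ → ℕ → ℕ → ℕ → ℕ → ℝ) : Prop :=
  ∀ a b c d e f : ℕ, co a b c d e f ≠ 0 →
    a + d + f = k ∧ b + e + f = m ∧ a + b + c = l ∧
    (d : ℝ) + (e : ℝ) + (f : ℝ) - (c : ℝ) = ((n : ℝ) + 1) * ν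

theorem semiInv_invComb {k m l : ℕ} {co : ℕ → ℕ → ℕ → ℕ → ℕ → ℕ → ℝ}
    (h : Admissible n k m l ν co) : SemiInv ν (pulled (invComb n k m l co)) := by
  have e : pulled (invComb n k m l co) = ∑ a ∈ Finset.range (k + 1), ∑ b ∈ Finset.range (m + 1),
      ∑ c ∈ Finset.range (l + 1), ∑ d ∈ Finset.range (k + 1), ∑ e ∈ Finset.range (m + 1),
      ∑ f ∈ Finset.range (k + 1), co a b c d e f • pulled (invMonomial n a b c d e f) := by
    funext z a b y
    simp only [Finset.sum_apply, Pi.smul_apply, smul_eq_mul]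
    rfl
  rw [e]
  refine .sum fun a _ => .sum fun b _ => .sum fun c _ => .sum fun d _ => .sum fun e _ =>
    .sum fun f _ => ?_
  by_cases h0 : co a b c d e f = 0
  · rw [h0, zero_smul]
    exact .zero
  · exact (semiInv_invMonomial a b c d e f (h a b c d e f h0).2.2.2).const_smul _

end SemiInvariants

section FiberCoefficients

variable {n : ℕ}

/-- The coefficient of `r ^ d * s ^ e * y ^ c` of a function that is polynomial in the last
components of its arguments. -/
def fiberCoeff (k m l : ℕ) (g : CtW n → CtW n → CtW n → ℝ) (d e c : ℕ) (v₁ v₂ v₃ : SpE n) : ℝ :=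
  interpCoeff l c fun y => interpCoeff m e fun s => interpCoeff k d fun r =>
    g (v₁, r) (v₂, s) (v₃, y)

/-- Smooth functions of three vectors that are homogeneous in each of them. -/
structure TriHomogeneous (k m l : ℕ) (g : CtW n → CtW n → CtW n → ℝ) : Prop where
  smooth : ContDiff ℝ (⊤ : ℕ∞) fun p : CtW n × CtW n × CtW n => g p.1 p.2.1 p.2.2
  hom₁ : ∀ (c : ℝ) a b y, g (c • a) b y = c ^ k * g a b y
  hom₂ : ∀ (c : ℝ) a b y, g a (c • b) y = c ^ m * g a b y
  hom₃ : ∀ (c : ℝ) a b y, g a b (c • y) = c ^ l * g a b y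

variable {k m l : ℕ} {g : CtW n → CtW n → CtW n → ℝ}

namespace TriHomogeneous

theorem poly₁ (H : TriHomogeneous k m l g) (b y a w : CtW n) :
    IsPolyLE k fun τ => g (a + τ • w) b y :=
  isPolyLE_of_homogeneous k (fun a => g a b y)
    (H.smooth.comp (contDiff_id.prodMk (contDiff_const (c := (b, y)))))
    (fun c a => H.hom₁ c a b y) a w

theorem poly₂ (H : TriHomogeneous k m l g) (a y b w : CtW n) :
    IsPolyLE m fun τ => g a (b + τ • w) y :=
  isPolyLE_of_homogeneous m (fun b => g a b y)
    (H.smooth.comp (contDiff_const.prodMk (contDiff_id.prodMk contDiff_const)))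
    (fun c b => H.hom₂ c a b y) b w

theorem poly₃ (H : TriHomogeneous k m l g) (a b y w : CtW n) :
    IsPolyLE l fun τ => g a b (y + τ • w) :=
  isPolyLE_of_homogeneous l (fun y => g a b y)
    (H.smooth.comp (contDiff_const.prodMk (contDiff_const.prodMk contDiff_id)))
    (fun c y => H.hom₃ c a b y) y w

theorem fiber_poly₁ (H : TriHomogeneous k m l g) (v₁ : SpE n) (b y : CtW n) :
    IsPolyLE k fun r => g (v₁, r) b y := by
  simpa using H.poly₁ b y (v₁, 0) (0, 1)

theorem fiber_poly₂ (H : TriHomogeneous k m l g) (d : ℕ) (v₁ v₂ : SpE n) (y : CtW n) :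
    IsPolyLE m fun s => interpCoeff k d fun r => g (v₁, r) (v₂, s) y :=
  IsPolyLE.interpCoeff fun r => by
    simpa using H.poly₂ (v₁, r) y (v₂, 0) (0, 1)

theorem fiber_poly₃ (H : TriHomogeneous k m l g) (d e : ℕ) (v₁ v₂ v₃ : SpE n) :
    IsPolyLE l fun y => interpCoeff m e fun s => interpCoeff k d fun r =>
      g (v₁, r) (v₂, s) (v₃, y) :=
  IsPolyLE.interpCoeff fun s => IsPolyLE.interpCoeff fun r => by
    simpa using H.poly₃ (v₁, r) (v₂, s) (v₃, 0) (0, 1)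

theorem eq_sum (H : TriHomogeneous k m l g) (v₁ v₂ v₃ : SpE n) (r s y : ℝ) :
    g (v₁, r) (v₂, s) (v₃, y) = ∑ d ∈ Finset.range (k + 1), ∑ e ∈ Finset.range (m + 1),
      ∑ c ∈ Finset.range (l + 1), fiberCoeff k m l g d e c v₁ v₂ v₃ * y ^ c * s ^ e * r ^ d := by
  rw [(H.fiber_poly₁ v₁ (v₂, s) (v₃, y)).eq_sum r]
  refine Finset.sum_congr rfl fun d _ => ?_
  rw [(H.fiber_poly₂ d v₁ v₂ (v₃, y)).eq_sum s, Finset.sum_mul]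
  refine Finset.sum_congr rfl fun e _ => ?_
  rw [(H.fiber_poly₃ d e v₁ v₂ v₃).eq_sum y, Finset.sum_mul, Finset.sum_mul]
  rfl

theorem smul₁ (H : TriHomogeneous k m l g) {d : ℕ} (hd : d ≤ k) (e c : ℕ) {t : ℝ} (ht : t ≠ 0)
    (v₁ v₂ v₃ : SpE n) : fiberCoeff k m l g d e c (t • v₁) v₂ v₃
      = t ^ (k - d) * fiberCoeff k m l g d e c v₁ v₂ v₃ := by
  have h : ∀ r b y, g (t • v₁, r) b y = t ^ k * g (v₁, t⁻¹ * r) b y := fun r b y => by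
    rw [← H.hom₁]; simp [ht]
  have h' : ∀ b y, interpCoeff k d (fun r => g (t • v₁, r) b y)
      = t ^ (k - d) * interpCoeff k d fun r => g (v₁, r) b y := fun b y => by
    simp only [h]
    rw [interpCoeff_const_mul, (H.fiber_poly₁ v₁ b y).interpCoeff_comp_mul, ← mul_assoc,
      pow_sub₀ _ ht hd, inv_pow]
  simp only [fiberCoeff, h', interpCoeff_const_mul]

theorem smul₂ (H : TriHomogeneous k m l g) (d : ℕ) {e : ℕ} (he : e ≤ m) (c : ℕ) {t : ℝ}
    (ht : t ≠ 0) (v₁ v₂ v₃ : SpE n) : fiberCoeff k m l g d e c v₁ (t • v₂) v₃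
      = t ^ (m - e) * fiberCoeff k m l g d e c v₁ v₂ v₃ := by
  have h : ∀ a s y, g a (t • v₂, s) y = t ^ m * g a (v₂, t⁻¹ * s) y := fun a s y => by
    rw [← H.hom₂]; simp [ht]
  have h' : ∀ y, interpCoeff m e (fun s => interpCoeff k d fun r => g (v₁, r) (t • v₂, s) y)
      = t ^ (m - e) * interpCoeff m e fun s => interpCoeff k d fun r => g (v₁, r) (v₂, s) y :=
    fun y => by
      simp only [h, interpCoeff_const_mul]
      rw [(H.fiber_poly₂ d v₁ v₂ y).interpCoeff_comp_mul, ← mul_assoc, pow_sub₀ _ ht he, inv_pow]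
  simp only [fiberCoeff, h', interpCoeff_const_mul]

theorem smul₃ (H : TriHomogeneous k m l g) (d e : ℕ) {c : ℕ} (hc : c ≤ l) {t : ℝ}
    (ht : t ≠ 0) (v₁ v₂ v₃ : SpE n) : fiberCoeff k m l g d e c v₁ v₂ (t • v₃)
      = t ^ (l - c) * fiberCoeff k m l g d e c v₁ v₂ v₃ := by
  have h : ∀ a b y, g a b (t • v₃, y) = t ^ l * g a b (v₃, t⁻¹ * y) := fun a b y => by
    rw [← H.hom₃]; simp [ht]
  simp only [fiberCoeff, h, interpCoeff_const_mul]
  rw [(H.fiber_poly₃ d e v₁ v₂ v₃).interpCoeff_comp_mul, ← mul_assoc, pow_sub₀ _ ht hc, inv_pow]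

theorem poly_line (H : TriHomogeneous k m l g) (d e c : ℕ) (v₁ v₂ u w : SpE n) :
    IsPolyLE l fun τ => fiberCoeff k m l g d e c v₁ v₂ (u + τ • w) :=
  IsPolyLE.interpCoeff fun y => IsPolyLE.interpCoeff fun s => IsPolyLE.interpCoeff fun r => by
    simpa using H.poly₃ (v₁, r) (v₂, s) (u, y) (w, 0)

theorem continuous_line (H : TriHomogeneous k m l g) (d e c : ℕ) (a a' b b' y y' : SpE n) :
    Continuous fun τ : ℝ => fiberCoeff k m l g d e c (a + τ • a') (b + τ • b') (y + τ • y') := by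
  simp only [fiberCoeff, interpCoeff]
  refine continuous_finsetSum _ fun i _ => Continuous.mul ?_ continuous_const
  refine continuous_finsetSum _ fun j _ => Continuous.mul ?_ continuous_const
  refine continuous_finsetSum _ fun j' _ => Continuous.mul ?_ continuous_const
  exact H.smooth.continuous.comp (f := fun τ : ℝ => (((a + τ • a', (j' : ℝ)) : CtW n),
    ((b + τ • b', (j : ℝ)) : CtW n), ((y + τ • y', (i : ℝ)) : CtW n))) (by fun_prop)

theorem fiberCoeff_rescale (H : TriHomogeneous k m l g) (d e c : ℕ) (t t' : ℝ)
    (v₁ v₂ v₃ : SpE n) :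
    fiberCoeff k m l (fun a b y => g (a.1, t * a.2) (b.1, t * b.2) (y.1, t' * y.2)) d e c v₁ v₂ v₃
      = t' ^ c * (t ^ e * (t ^ d * fiberCoeff k m l g d e c v₁ v₂ v₃)) := by
  simp only [fiberCoeff]
  have h1 : ∀ b y, interpCoeff k d (fun r => g (v₁, t * r) b y)
      = t ^ d * interpCoeff k d fun r => g (v₁, r) b y := fun b y =>
    (H.fiber_poly₁ v₁ b y).interpCoeff_comp_mul d t
  have h2 : ∀ y, interpCoeff m e (fun s => interpCoeff k d fun r => g (v₁, r) (v₂, t * s) y)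
      = t ^ e * interpCoeff m e fun s => interpCoeff k d fun r => g (v₁, r) (v₂, s) y := fun y =>
    (H.fiber_poly₂ d v₁ v₂ y).interpCoeff_comp_mul e t
  simp only [h1, interpCoeff_const_mul, h2]
  rw [(H.fiber_poly₃ d e v₁ v₂ v₃).interpCoeff_comp_mul]
  ring

theorem weight_eq (H : TriHomogeneous k m l g) {W : ℝ}
    (hdil : ∀ (s : ℝ) a b y, g (Real.exp s • a.1, Real.exp (2 * s) * a.2)
      (Real.exp s • b.1, Real.exp (2 * s) * b.2)
      (Real.exp (-s) • y.1, Real.exp (-(2 * s)) * y.2) = Real.exp (2 * W * s) * g a b y)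
    {d e c : ℕ} {v₁ v₂ v₃ : SpE n} (hne : fiberCoeff k m l g d e c v₁ v₂ v₃ ≠ 0) :
    (k : ℝ) + m + d + e - l - c = 2 * W := by
  set t := Real.exp 1 with ht
  have ht0 : t ≠ 0 := (Real.exp_pos 1).ne'
  have e2 : Real.exp (2 * 1) = t * t := by rw [ht, ← Real.exp_add]; norm_num
  have hs : ∀ a b y, t ^ k * (t ^ m * (t⁻¹ ^ l * g (a.1, t * a.2) (b.1, t * b.2)
      (y.1, t⁻¹ * y.2))) = Real.exp (2 * W) * g a b y := fun a b y => by
    have h := hdil 1 a b y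
    rw [mul_one (2 * W), Real.exp_neg, Real.exp_neg, ← ht, e2] at h
    rw [← h, ← H.hom₃, ← H.hom₂, ← H.hom₁]
    simp only [Prod.smul_mk, smul_eq_mul, mul_inv, mul_assoc]
  have hF : t ^ k * (t ^ m * (t⁻¹ ^ l * (t⁻¹ ^ c * (t ^ e * (t ^ d *
      fiberCoeff k m l g d e c v₁ v₂ v₃)))))
      = Real.exp (2 * W) * fiberCoeff k m l g d e c v₁ v₂ v₃ := by
    rw [← H.fiberCoeff_rescale]
    simp only [fiberCoeff, ← interpCoeff_const_mul]
    simp only [← hs]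
  have hE : t ^ k * (t ^ m * (t⁻¹ ^ l * (t⁻¹ ^ c * (t ^ e * t ^ d)))) = Real.exp (2 * W) :=
    mul_right_cancel₀ hne (by rw [← hF]; ring)
  rw [ht, ← Real.exp_neg] at hE
  simp only [← Real.exp_nat_mul, ← Real.exp_add] at hE
  have := Real.exp_injective hE
  linarith

end TriHomogeneous

theorem fiberCoeff_eq_zero_or (hn : 1 ≤ n) (H : TriHomogeneous k m l g) {W : ℝ}
    (hinv : ∀ u c (a b y : CtW n), g (transv (symp n) u c a.1, a.2)
      (transv (symp n) u c b.1, b.2) (transv (symp n) u c y.1, y.2) = g a b y)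
    (hdil : ∀ (s : ℝ) a b y, g (Real.exp s • a.1, Real.exp (2 * s) * a.2)
      (Real.exp s • b.1, Real.exp (2 * s) * b.2)
      (Real.exp (-s) • y.1, Real.exp (-(2 * s)) * y.2) = Real.exp (2 * W * s) * g a b y)
    {d e c : ℕ} (hd : d ≤ k) (he : e ≤ m) (hc : c ≤ l) :
    (∀ v₁ v₂ v₃, fiberCoeff k m l g d e c v₁ v₂ v₃ = 0) ∨
      ∃ (α β γ : ℕ) (C : ℝ), α + β + d = k ∧ α + γ + e = m ∧ β + γ + c = l ∧
        (d : ℝ) + e + α - c = W ∧ ∀ v₁ v₂ v₃, fiberCoeff k m l g d e c v₁ v₂ v₃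
          = C * symp n v₁ v₂ ^ α * symp n v₁ v₃ ^ β * symp n v₂ v₃ ^ γ := by
  by_cases h0 : ∀ v₁ v₂ v₃, fiberCoeff k m l g d e c v₁ v₂ v₃ = 0
  · exact Or.inl h0
  have hef : symp n (0, Pi.single ⟨0, hn⟩ 1) (Pi.single ⟨0, hn⟩ 1, 0) = 1 := by
    simp [symp_apply]
  rcases symplectic_invariant_of_three_vectors symp_isAlt symp_nondegenerate hef
    (fiberCoeff k m l g d e c) (H.continuous_line d e c) (H.poly_line d e c)
    (fun t ht => H.smul₁ hd e c ht) (fun t ht => H.smul₂ d he c ht)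
    (fun t ht => H.smul₃ d e hc ht)
    (fun u t v₁ v₂ v₃ => by simp only [fiberCoeff]; simp only [hinv u t (_, _) (_, _) (_, _)])
    with h | ⟨α, β, γ, C, h1, h2, h3, h4⟩
  · exact absurd h h0
  push Not at h0
  obtain ⟨v₁, v₂, v₃, hv⟩ := h0
  have hw := H.weight_eq hdil hv
  refine Or.inr ⟨α, β, γ, C, by omega, by omega, by omega, ?_, h4⟩
  have e1 : (k : ℝ) = α + β + d := by rw [← Nat.cast_add, ← Nat.cast_add]; congr 1; omega
  have e2 : (m : ℝ) = α + γ + e := by rw [← Nat.cast_add, ← Nat.cast_add]; congr 1; omega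
  have e3 : (l : ℝ) = β + γ + c := by rw [← Nat.cast_add, ← Nat.cast_add]; congr 1; omega
  linarith

end FiberCoefficients

section Classification

variable {n k m l : ℕ} {ν : ℝ}

/-- The functions of three vectors given at the origin by admissible combinations of the
distinguished invariants. -/
def IsComb (n k m l : ℕ) (ν : ℝ) (g : CtW n → CtW n → CtW n → ℝ) : Prop :=
  ∃ co, Admissible n k m l ν co ∧ ∀ a b y, g a b y = pulled (invComb n k m l co) 0 a b y

variable {g g' : CtW n → CtW n → CtW n → ℝ}

theorem IsComb.add (h : IsComb n k m l ν g) (h' : IsComb n k m l ν g') :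
    IsComb n k m l ν fun a b y => g a b y + g' a b y := by
  obtain ⟨co, h1, h2⟩ := h
  obtain ⟨co', h1', h2'⟩ := h'
  refine ⟨fun a b c d e f => co a b c d e f + co' a b c d e f, fun a b c d e f h => ?_,
    fun a b y => ?_⟩
  · by_cases h0 : co a b c d e f = 0
    · exact h1' a b c d e f fun h0' => h (by simp only [h0, h0', add_zero])
    · exact h1 a b c d e f h0
  · simp only [h2, h2', pulled, invComb, add_mul, Finset.sum_add_distrib]

theorem IsComb.const_mul (C : ℝ) (h : IsComb n k m l ν g) :
    IsComb n k m l ν fun a b y => C * g a b y := by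
  obtain ⟨co, h1, h2⟩ := h
  refine ⟨fun a b c d e f => C * co a b c d e f, fun a b c d e f h => ?_, fun a b y => ?_⟩
  · exact h1 a b c d e f (right_ne_zero_of_mul h)
  · simp only [h2, pulled, invComb, mul_assoc, Finset.mul_sum]

theorem IsComb.zero : IsComb n k m l ν fun _ _ _ => 0 :=
  ⟨fun _ _ _ _ _ _ => 0, fun _ _ _ _ _ _ h => absurd rfl h, fun _ _ _ => by
    simp [pulled, invComb]⟩

theorem IsComb.sum {ι : Type*} {s : Finset ι} {G : ι → CtW n → CtW n → CtW n → ℝ}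
    (h : ∀ i ∈ s, IsComb n k m l ν (G i)) : IsComb n k m l ν fun a b y => ∑ i ∈ s, G i a b y := by
  have := Finset.sum_induction G (IsComb n k m l ν) (fun _ _ h h' => h.add h') .zero h
  convert this using 4
  simp only [Finset.sum_apply]

theorem isComb_invMonomial {a b c d e f : ℕ} (h1 : a + d + f = k) (h2 : b + e + f = m)
    (h3 : a + b + c = l) (h4 : (d : ℝ) + (e : ℝ) + (f : ℝ) - (c : ℝ) = ((n : ℝ) + 1) * ν) :
    IsComb n k m l ν (pulled (invMonomial n a b c d e f) 0) := by
  refine ⟨fun a' b' c' d' e' f' =>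
    if a' = a ∧ b' = b ∧ c' = c ∧ d' = d ∧ e' = e ∧ f' = f then 1 else 0,
    fun a' b' c' d' e' f' h => ?_, fun x y z => ?_⟩
  · obtain ⟨⟨rfl, rfl, rfl, rfl, rfl, rfl⟩, -⟩ := ite_ne_right_iff.mp h
    exact ⟨h1, h2, h3, h4⟩
  · simp only [pulled, invComb, ite_and, ite_mul, zero_mul, one_mul, Finset.sum_ite_irrel,
      Finset.sum_ite_eq', Finset.sum_const_zero, Finset.mem_range]
    rw [if_pos (by omega), if_pos (by omega), if_pos (by omega), if_pos (by omega),
      if_pos (by omega), if_pos (by omega)]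

theorem isComb_monomial {α β γ c d e : ℕ} (h1 : α + β + d = k) (h2 : α + γ + e = m)
    (h3 : β + γ + c = l) (h4 : (d : ℝ) + (e : ℝ) + (α : ℝ) - (c : ℝ) = ((n : ℝ) + 1) * ν) :
    IsComb n k m l ν fun a b y => symp n a.1 b.1 ^ α * symp n a.1 y.1 ^ β * symp n b.1 y.1 ^ γ
      * y.2 ^ c * b.2 ^ e * a.2 ^ d := by
  have key : ∀ i ∈ Finset.range (β + 1), ∀ j ∈ Finset.range (γ + 1),
      IsComb n k m l ν (pulled (invMonomial n i j (c + (β - i) + (γ - j)) (d + (β - i))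
        (e + (γ - j)) α) 0) := fun i hi j hj => by
    rw [Finset.mem_range] at hi hj
    refine isComb_invMonomial (by omega) (by omega) (by omega) ?_
    push_cast [Nat.cast_sub (Nat.lt_succ_iff.mp hi), Nat.cast_sub (Nat.lt_succ_iff.mp hj)]
    linarith
  have H := (IsComb.sum fun i hi => IsComb.sum fun j hj => (key i hi j hj).const_mul
    ((-1) ^ (β - i) * β.choose i * ((-1) ^ (γ - j) * γ.choose j))).const_mul
    ((-1) ^ α * (-2) ^ c * (-(1 / 2)) ^ e * (-(1 / 2)) ^ d)
  convert H using 4 with a b y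
  have hm : ∀ i j c d e, pulled (invMonomial n i j c d e α) 0 a b y
      = pulled (u1 n) 0 a b y ^ i * pulled (u2 n) 0 a b y ^ j * pulled (u3 n) 0 a b y ^ c
        * pulled (u4 n) 0 a b y ^ d * pulled (u5 n) 0 a b y ^ e * pulled (L1p n) 0 a b y ^ α :=
    fun _ _ _ _ _ => rfl
  have e1 : symp n a.1 b.1 = -1 * pulled (L1p n) 0 a b y := by rw [pulled_L1p]; simp
  have e2 : symp n a.1 y.1 = pulled (u1 n) 0 a b y
      + -1 * (pulled (u3 n) 0 a b y * pulled (u4 n) 0 a b y) := by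
    rw [pulled_u1, pulled_u3, pulled_u4]; simp; ring
  have e3 : symp n b.1 y.1 = pulled (u2 n) 0 a b y
      + -1 * (pulled (u3 n) 0 a b y * pulled (u5 n) 0 a b y) := by
    rw [pulled_u2, pulled_u3, pulled_u5]; simp; ring
  have e4 : y.2 = -2 * pulled (u3 n) 0 a b y := by rw [pulled_u3]; simp
  have e5 : b.2 = -(1 / 2) * pulled (u5 n) 0 a b y := by rw [pulled_u5]; ring
  have e6 : a.2 = -(1 / 2) * pulled (u4 n) 0 a b y := by rw [pulled_u4]; ring
  simp only [hm]
  rw [e1, e2, e3, e4, e5, e6]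
  generalize pulled (u1 n) 0 a b y = U₁, pulled (u2 n) 0 a b y = U₂, pulled (u3 n) 0 a b y = U₃,
    pulled (u4 n) 0 a b y = U₄, pulled (u5 n) 0 a b y = U₅, pulled (L1p n) 0 a b y = L
  rw [add_pow, add_pow]
  simp only [Finset.mul_sum, Finset.sum_mul]
  rw [Finset.sum_comm]
  refine Finset.sum_congr rfl fun i _ => Finset.sum_congr rfl fun j _ => ?_
  simp only [mul_pow, pow_add]
  ring

theorem triHomogeneous_pulled {Q : Vc n → Vc n → Vc n → Vc n → ℝ} (hQ : InS n k m l Q)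
    (z : CtW n) : TriHomogeneous k m l (pulled Q z) where
  smooth := hQ.1.comp ((coordMap n).contDiff.comp
    (f := fun p : CtW n × CtW n × CtW n => ((z, p.1), (p.2.1, p.2.2))) (by fun_prop))
  hom₁ c a b y := by simp only [pulled, map_smul, hQ.2.1]
  hom₂ c a b y := by simp only [pulled, map_smul, hQ.2.2.1]
  hom₃ c a b y := by simp only [pulled, map_smul, hQ.2.2.2]

theorem Killed.isComb (hn : 1 ≤ n) {P : CtW n → CtW n → CtW n → CtW n → ℝ} (H : Killed ν P)
    (hP : Differentiable ℝ (uncurried P)) (hg : TriHomogeneous k m l (P 0)) :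
    IsComb n k m l ν (P 0) := by
  have e : P 0 = fun a b y => ∑ d ∈ Finset.range (k + 1), ∑ e ∈ Finset.range (m + 1),
      ∑ c ∈ Finset.range (l + 1),
        fiberCoeff k m l (P 0) d e c a.1 b.1 y.1 * y.2 ^ c * b.2 ^ e * a.2 ^ d := by
    funext a b y
    exact hg.eq_sum a.1 b.1 y.1 a.2 b.2 y.2
  rw [e]
  refine .sum fun d hd => .sum fun e he => .sum fun c hc => ?_
  rw [Finset.mem_range, Nat.lt_succ_iff] at hd he hc
  rcases fiberCoeff_eq_zero_or hn hg (H.transv_invariant hP) (H.dilation hP) hd he hc with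
    h | ⟨α, β, γ, C, h1, h2, h3, h4, h5⟩
  · simpa only [h, zero_mul] using IsComb.zero
  · simpa only [h5, mul_assoc] using (isComb_monomial h1 h2 h3 h4).const_mul C

theorem exists_eq_invComb (hn : 1 ≤ n) {Q : Vc n → Vc n → Vc n → Vc n → ℝ}
    (hQ : InS n k m l Q) (H : Killed ν (pulled Q)) :
    ∃ co, Admissible n k m l ν co ∧ Q = invComb n k m l co := by
  have hd : Differentiable ℝ (uncurried (pulled Q)) :=
    Differentiable.pulled (hQ.1.differentiable (by simp))
  obtain ⟨co, h1, h2⟩ := H.isComb hn hd (triHomogeneous_pulled hQ 0)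
  have hI := semiInv_invComb h1
  have e := H.eq_of_eq_at_origin hd hI.2 hI.1 h2
  refine ⟨co, h1, ?_⟩
  funext x ξ η Y
  obtain ⟨z, rfl⟩ := exists_vecL x
  obtain ⟨a, rfl⟩ := exists_covL ξ
  obtain ⟨b, rfl⟩ := exists_covL η
  obtain ⟨y, rfl⟩ := exists_vecL Y
  exact congrFun (congrFun (congrFun (congrFun e z) a) b) y

end Classification

/-- `Q ∈ S^{km}_{ℓ;ν}` is invariant under all affine contact vector fields iff it is a
linear combination of the monomials `u_1^a u_2^b u_3^c u_4^d u_5^e L_1^f` over the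
solutions of `a+d+f = k`, `b+e+f = m`, `a+b+c = ℓ`, `d+e+f−c = (n+1)ν`. -/
theorem stmt14 (n : ℕ) (hn : 1 ≤ n) (k m l : ℕ) (ν : ℝ)
    (Q : Vc n → Vc n → Vc n → Vc n → ℝ) (hQ : InS n k m l Q) :
    (∀ h, IsAffGen n h → ∀ x ξ η Y, LAct3 n ν (contactHam n h) Q x ξ η Y = 0)
    ↔ ∃ co : ℕ → ℕ → ℕ → ℕ → ℕ → ℕ → ℝ,
        (∀ a b c d e f : ℕ, co a b c d e f ≠ 0 →
          a + d + f = k ∧ b + e + f = m ∧ a + b + c = l ∧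
          (d : ℝ) + (e : ℝ) + (f : ℝ) - (c : ℝ) = ((n : ℝ)+1) * ν) ∧
        ∀ x ξ η Y, Q x ξ η Y =
          ∑ a ∈ Finset.range (k+1), ∑ b ∈ Finset.range (m+1), ∑ c ∈ Finset.range (l+1),
          ∑ d ∈ Finset.range (k+1), ∑ e ∈ Finset.range (m+1), ∑ f ∈ Finset.range (k+1),
            co a b c d e f * u1 n x ξ η Y ^ a * u2 n x ξ η Y ^ b * u3 n x ξ η Y ^ c
              * u4 n x ξ η Y ^ d * u5 n x ξ η Y ^ e * L1p n x ξ η Y ^ f := by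
  rw [invariant_iff_killed (hQ.1.differentiable (by simp))]
  constructor
  · intro H
    obtain ⟨co, h1, rfl⟩ := exists_eq_invComb hn hQ H
    exact ⟨co, h1, fun x ξ η Y => by simp only [invComb, invMonomial, mul_assoc]⟩
  · rintro ⟨co, h1, h2⟩
    have : Q = invComb n k m l co := by
      funext x ξ η Y
      simp only [h2, invComb, invMonomial, mul_assoc]
    rw [this]
    exact (semiInv_invComb h1).2
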